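/- arXiv:2509.25949 — 2 statements merged into one kernel-verified Lean document; each statement's English description precedes it below -/
import Mathlib

section
/- For any positive integer t with t ≥ 2, let μ = (5t + 2)/2 + 1/(t − 1). Then the anti-Ramsey number of P₃ ∪ tP₂ satisfies: AR(n, P₃ ∪ tP₂) = t(2t − 1) + 1 whenever 2t + 3 ≤ n ≤ ⌊μ⌋, and AR(n, P₃ ∪ tP₂) = (t − 1)(n − t/2) + 1 = (t − 1)(2n − t)/2 + 1 whenever n ≥ ⌈μ⌉. -/
open SimpleGraph

/-- The number of colors used by an edge-coloring `c` of the complete graph `K_n`. -/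
noncomputable def colorCount (n : ℕ) (c : Sym2 (Fin n) → ℕ) : ℕ :=
  (c '' (⊤ : SimpleGraph (Fin n)).edgeSet).ncard

/-- The linear forest `kP₃ ∪ tP₂`: the vertex-disjoint union of `k` paths on 3 vertices
and `t` paths on 2 vertices. -/
def linearForest (k t : ℕ) : SimpleGraph (Fin k × Fin 3 ⊕ Fin t × Fin 2) :=
  SimpleGraph.fromRel (fun u v =>
    (∃ (i : Fin k) (a b : Fin 3), u = Sum.inl (i, a) ∧ v = Sum.inl (i, b) ∧ (a : ℕ) + 1 = (b : ℕ)) ∨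
    (∃ j : Fin t, u = Sum.inr (j, 0) ∧ v = Sum.inr (j, 1)))

/-- `G` (edge-colored by `c`) contains a rainbow subgraph isomorphic to `F`:
there is an injective graph homomorphism from `F` to `G` under which the edges of `F`
receive pairwise distinct colors. -/
def HasRainbowCopy {V W : Type} (F : SimpleGraph V) (G : SimpleGraph W)
    (c : Sym2 W → ℕ) : Prop :=
  ∃ f : F →g G, Function.Injective f ∧
    Set.InjOn (fun e => c (Sym2.map (⇑f) e)) F.edgeSet

/-- The anti-Ramsey number `AR(n, F)`: the maximum number of colors in an edge-coloring
of `K_n` admitting no rainbow copy of `F`. -/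
noncomputable def antiRamsey {V : Type} (n : ℕ) (F : SimpleGraph V) : ℕ :=
  sSup {m | ∃ c : Sym2 (Fin n) → ℕ, colorCount n c = m ∧
    ¬ HasRainbowCopy F (⊤ : SimpleGraph (Fin n)) c}

/-- The endpoints of a list of edges. -/
def edgeVerts {V : Type*} (L : List (V × V)) : List V := L.flatMap fun p => [p.1, p.2]

/-- The colors of a list of edges. -/
def edgeColors {V : Type*} (c : Sym2 V → ℕ) (L : List (V × V)) : List ℕ :=
  L.map fun p => c s(p.1, p.2)

section lists

variable {V W : Type*} {c : Sym2 V → ℕ}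

@[simp] lemma edgeVerts_nil : edgeVerts ([] : List (V × V)) = [] := rfl

@[simp] lemma edgeVerts_cons (p : V × V) (L : List (V × V)) :
    edgeVerts (p :: L) = p.1 :: p.2 :: edgeVerts L := rfl

@[simp] lemma edgeVerts_append (L L' : List (V × V)) :
    edgeVerts (L ++ L') = edgeVerts L ++ edgeVerts L' := by
  simp [edgeVerts]

lemma mem_edgeVerts {L : List (V × V)} {v : V} :
    v ∈ edgeVerts L ↔ ∃ p ∈ L, v = p.1 ∨ v = p.2 := by
  simp [edgeVerts]

@[simp] lemma edgeColors_nil : edgeColors c [] = [] := rfl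

@[simp] lemma edgeColors_cons (p : V × V) (L : List (V × V)) :
    edgeColors c (p :: L) = c s(p.1, p.2) :: edgeColors c L := rfl

@[simp] lemma edgeColors_append (L L' : List (V × V)) :
    edgeColors c (L ++ L') = edgeColors c L ++ edgeColors c L' := by
  simp [edgeColors]

lemma mem_edgeColors {L : List (V × V)} {k : ℕ} :
    k ∈ edgeColors c L ↔ ∃ p ∈ L, c s(p.1, p.2) = k := by
  simp [edgeColors]

lemma List.Perm.edgeVerts {L L' : List (V × V)} (h : L.Perm L') :
    (edgeVerts L).Perm (_root_.edgeVerts L') := h.flatMap_right _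

lemma List.Perm.edgeColors {L L' : List (V × V)} (h : L.Perm L') :
    (edgeColors c L).Perm (_root_.edgeColors c L') := h.map _

lemma List.Sublist.edgeVerts {L L' : List (V × V)} (h : L.Sublist L') :
    (edgeVerts L).Sublist (_root_.edgeVerts L') := h.flatMap _

lemma List.Sublist.edgeColors {L L' : List (V × V)} (h : L.Sublist L') :
    (edgeColors c L).Sublist (_root_.edgeColors c L') := h.map _

/-- The list of edges is a matching with pairwise distinct colors. -/
def IsRainbowMatching (c : Sym2 V → ℕ) (L : List (V × V)) : Prop :=
  (edgeVerts L).Nodup ∧ (edgeColors c L).Nodup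

/-- There is a rainbow matching with `k` edges. -/
def HasRainbowMatching (c : Sym2 V → ℕ) (k : ℕ) : Prop :=
  ∃ L, IsRainbowMatching c L ∧ L.length = k

/-- There is a rainbow `P₃ ∪ kP₂`. -/
def HasRainbowForest (c : Sym2 V → ℕ) (k : ℕ) : Prop :=
  ∃ x y z L, (x :: y :: z :: edgeVerts L).Nodup ∧
    (c s(x, y) :: c s(y, z) :: edgeColors c L).Nodup ∧ L.length = k

lemma edgeVerts_map (f : W → V) (L : List (W × W)) :
    edgeVerts (L.map (Prod.map f f)) = (edgeVerts L).map f := by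
  induction L with
  | nil => rfl
  | cons p L ih => simp [ih]

lemma edgeColors_map (f : W → V) (L : List (W × W)) :
    edgeColors c (L.map (Prod.map f f)) = edgeColors (c ∘ Sym2.map f) L := by
  induction L with
  | nil => rfl
  | cons p L ih => simp [ih]

lemma HasRainbowMatching.of_comp {f : W → V} (hf : Function.Injective f) {k : ℕ}
    (h : HasRainbowMatching (c ∘ Sym2.map f) k) : HasRainbowMatching c k := by
  obtain ⟨L, ⟨h1, h2⟩, h3⟩ := h
  refine ⟨L.map (Prod.map f f), ⟨?_, ?_⟩, by simpa using h3⟩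
  · rw [edgeVerts_map]; exact h1.map hf
  · rwa [edgeColors_map]

lemma HasRainbowForest.of_comp {f : W → V} (hf : Function.Injective f) {k : ℕ}
    (h : HasRainbowForest (c ∘ Sym2.map f) k) : HasRainbowForest c k := by
  obtain ⟨x, y, z, L, h1, h2, h3⟩ := h
  refine ⟨f x, f y, f z, L.map (Prod.map f f), ?_, ?_, by simpa using h3⟩
  · rw [edgeVerts_map]; simpa using h1.map hf
  · rw [edgeColors_map]; simpa using h2

lemma HasRainbowForest.mono {k l : ℕ} (h : HasRainbowForest c l) (hkl : k ≤ l) :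
    HasRainbowForest c k := by
  obtain ⟨x, y, z, L, h1, h2, h3⟩ := h
  have hs : (L.take k).Sublist L := List.take_sublist _ _
  exact ⟨x, y, z, L.take k, h1.sublist (((hs.edgeVerts.cons_cons _).cons_cons _).cons_cons _),
    h2.sublist ((hs.edgeColors.cons_cons _).cons_cons _), by simp; omega⟩

/-- Removing at most one edge from a rainbow matching avoids a given color. -/
lemma IsRainbowMatching.exists_avoiding {L : List (V × V)} (h : IsRainbowMatching c L) (k : ℕ) :
    ∃ L', L'.Sublist L ∧ k ∉ edgeColors c L' ∧ L.length ≤ L'.length + 1 := by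
  obtain ⟨-, h⟩ := h
  induction L with
  | nil => exact ⟨[], by simp⟩
  | cons p L ih =>
    simp only [edgeColors_cons, List.nodup_cons] at h
    by_cases hk : c s(p.1, p.2) = k
    · exact ⟨L, by simp, hk ▸ h.1, by simp⟩
    · obtain ⟨L', h1, h2, h3⟩ := ih h.2
      exact ⟨p :: L', h1.cons_cons _, by simp [h2, Ne.symm hk], by simpa using h3⟩

lemma IsRainbowMatching.sublist {L L' : List (V × V)} (h : IsRainbowMatching c L)
    (hs : L'.Sublist L) : IsRainbowMatching c L' :=
  ⟨h.1.sublist hs.edgeVerts, h.2.sublist hs.edgeColors⟩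

lemma IsRainbowMatching.perm {L L' : List (V × V)} (h : IsRainbowMatching c L)
    (hs : L.Perm L') : IsRainbowMatching c L' :=
  ⟨hs.edgeVerts.nodup h.1, hs.edgeColors.nodup h.2⟩

/-- An edge of a rainbow matching at a given vertex may be moved to the front, oriented so that
it starts at that vertex. -/
lemma IsRainbowMatching.exists_cons {L : List (V × V)} (h : IsRainbowMatching c L) {a : V}
    (ha : a ∈ edgeVerts L) : ∃ b L', IsRainbowMatching c ((a, b) :: L') ∧
      (∀ v, v ∈ edgeVerts L ↔ v = a ∨ v = b ∨ v ∈ edgeVerts L') ∧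
      (∀ k, k ∈ edgeColors c L ↔ k = c s(a, b) ∨ k ∈ edgeColors c L') ∧
      L.length = L'.length + 1 := by
  classical
  obtain ⟨p, hp, hap⟩ := mem_edgeVerts.1 ha
  have hperm := List.perm_cons_erase hp
  have h' := h.perm hperm
  have hv := fun v => hperm.edgeVerts.mem_iff (a := v)
  have hc := fun v => (hperm.edgeColors (c := c)).mem_iff (a := v)
  have hl := hperm.length_eq
  rcases hap with rfl | rfl
  · exact ⟨p.2, L.erase p, h', by simpa using hv, by simpa using hc, by simpa using hl⟩
  · refine ⟨p.1, L.erase p, ?_, ?_, ?_, by simpa using hl⟩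
    · unfold IsRainbowMatching at h' ⊢
      simp only [edgeVerts_cons, edgeColors_cons, List.nodup_cons, List.mem_cons] at h' ⊢
      rw [Sym2.eq_swap]
      tauto
    · intro v; rw [hv]; simp; tauto
    · intro v; rw [hc, Sym2.eq_swap]; simp

lemma HasRainbowForest.of_matching_path {L : List (V × V)} {x y z : V}
    (h : IsRainbowMatching c ((y, z) :: L)) (hxy : x ≠ y) (hxz : x ≠ z)
    (hx : x ∉ edgeVerts L) (hc : c s(x, y) ≠ c s(y, z)) (hcL : c s(x, y) ∉ edgeColors c L) :
    HasRainbowForest c L.length := by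
  refine ⟨x, y, z, L, ?_, ?_, rfl⟩
  · have := h.1
    simp_all
  · have := h.2
    simp_all

end lists

section extension

variable {V : Type*} {c : Sym2 V → ℕ}

/-- The colors appearing on the edges of the complete graph. -/
def usedColors [Fintype V] [DecidableEq V] (c : Sym2 V → ℕ) : Finset ℕ :=
  (Finset.univ.filter fun e : Sym2 V => ¬ e.IsDiag).image c

lemma mem_usedColors [Fintype V] [DecidableEq V] {k : ℕ} :
    k ∈ usedColors c ↔ ∃ a b, a ≠ b ∧ c s(a, b) = k := by
  simp only [usedColors, Finset.mem_image, Finset.mem_filter, Finset.mem_univ, true_and]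
  constructor
  · rintro ⟨e, he, rfl⟩
    induction e with
    | h a b => exact ⟨a, b, by simpa using he, rfl⟩
  · rintro ⟨a, b, hab, rfl⟩
    exact ⟨s(a, b), by simpa using hab, rfl⟩

lemma HasRainbowForest.of_mem_edgeVerts {L : List (V × V)} (h : IsRainbowMatching c L) {t : ℕ}
    (hL : t + 2 ≤ L.length) {a b : V} (hab : a ≠ b) (ha : a ∈ edgeVerts L)
    (hc : c s(a, b) ∉ edgeColors c L) : HasRainbowForest c t := by
  obtain ⟨a', L', h', hv, hcol, hl⟩ := h.exists_cons ha
  have hcol' := mt (hcol _).2 hc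
  push Not at hcol'
  have hba' : b ≠ a' := by rintro rfl; exact hcol'.1 rfl
  by_cases hb : b ∈ edgeVerts L'
  · have hL' : IsRainbowMatching c L' := h'.sublist (List.sublist_cons_self _ _)
    obtain ⟨b', L'', h'', hv', hcol'', hl'⟩ := hL'.exists_cons hb
    refine (HasRainbowForest.of_matching_path (c := c) (x := b) (y := a) (z := a') (L := L'')
      ?_ hab.symm hba' ?_ ?_ ?_).mono (by omega)
    · have h1 := h'.1
      have h2 := h'.2
      have h3 := h''.1
      have h4 := h''.2
      simp only [edgeVerts_cons, edgeColors_cons, List.nodup_cons, List.mem_cons, hv', hcol'']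
        at h1 h2 h3 h4
      refine ⟨?_, ?_⟩ <;>
      simp only [edgeVerts_cons, edgeColors_cons, List.nodup_cons, List.mem_cons] <;> tauto
    · have h3 := h''.1
      simp only [edgeVerts_cons, List.nodup_cons, List.mem_cons] at h3
      tauto
    · rw [Sym2.eq_swap]; exact hcol'.1
    · rw [Sym2.eq_swap]; exact fun h => hcol'.2 ((hcol'' _).2 (Or.inr h))
  · refine (HasRainbowForest.of_matching_path (c := c) (x := b) (y := a) (z := a') (L := L')
      h' hab.symm hba' hb ?_ ?_).mono (by omega)
    · rw [Sym2.eq_swap]; exact hcol'.1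
    · rw [Sym2.eq_swap]; exact hcol'.2

lemma HasRainbowForest.of_matching_add_three {t : ℕ} (h : HasRainbowMatching c (t + 3)) :
    HasRainbowForest c t := by
  obtain ⟨L, h, hl⟩ := h
  match L, hl with
  | p :: q :: L, hl =>
  simp only [List.length_cons] at hl
  have h1 := h.1
  have h2 := h.2
  simp only [edgeVerts_cons, edgeColors_cons, List.nodup_cons, List.mem_cons, not_or] at h1 h2
  have hL : IsRainbowMatching c L :=
    h.sublist ((List.sublist_cons_self _ _).trans (List.sublist_cons_self _ _))
  obtain ⟨L', hs, hk, hlen⟩ := hL.exists_avoiding (c s(p.1, q.1))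
  have hv := fun v => hs.edgeVerts.subset (a := v)
  have hc := fun v => (hs.edgeColors (c := c)).subset (a := v)
  by_cases hp : c s(p.1, q.1) = c s(p.1, p.2)
  · refine (HasRainbowForest.of_matching_path (c := c) (x := p.1) (y := q.1) (z := q.2) (L := L')
      (h.sublist ((hs.cons_cons _).trans (List.sublist_cons_self _ _))) ?_ ?_ ?_ ?_ hk).mono
      (by omega) <;> grind
  · refine (HasRainbowForest.of_matching_path (c := c) (x := q.1) (y := p.1) (z := p.2) (L := L')
      (h.sublist ((hs.trans (List.sublist_cons_self _ _)).cons_cons _)) ?_ ?_ ?_ ?_ ?_).mono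
      (by omega) <;> grind [Sym2.eq_swap]

lemma HasRainbowForest.of_matching_add_two [Fintype V] [DecidableEq V] {t : ℕ}
    (hcard : t + 3 ≤ (usedColors c).card) (h : HasRainbowMatching c (t + 2)) :
    HasRainbowForest c t := by
  obtain ⟨L, h, hl⟩ := h
  obtain ⟨k, hk, hkL⟩ := Finset.exists_mem_notMem_of_card_lt_card
    (s := (edgeColors c L).toFinset) (t := usedColors c) (by
      refine lt_of_le_of_lt (List.toFinset_card_le _) ?_
      simp only [edgeColors, List.length_map]; omega)
  obtain ⟨a, b, hab, rfl⟩ := mem_usedColors.1 hk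
  rw [List.mem_toFinset] at hkL
  by_cases ha : a ∈ edgeVerts L
  · exact .of_mem_edgeVerts h hl.ge hab ha hkL
  by_cases hb : b ∈ edgeVerts L
  · exact .of_mem_edgeVerts h hl.ge hab.symm hb (by rwa [Sym2.eq_swap])
  · refine .of_matching_add_three ⟨(a, b) :: L, ⟨?_, ?_⟩, by simp [hl]⟩
    · simp [ha, hb, hab, h.1]
    · simp [hkL, h.2]

/-- If there is no rainbow `P₃ ∪ tP₂`, then every edge leaving a rainbow `(t + 1)`-matching
repeats a color of that matching. -/
lemma IsRainbowMatching.mem_edgeColors_of_notMem [Fintype V] [DecidableEq V] {t : ℕ}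
    (hcard : t + 3 ≤ (usedColors c).card) (hF : ¬ HasRainbowForest c t)
    {L : List (V × V)} (h : IsRainbowMatching c L) (hl : L.length = t + 1) {w w' : V}
    (hw : w ∉ edgeVerts L) (hww : w ≠ w') : c s(w, w') ∈ edgeColors c L := by
  by_contra hc
  apply hF
  by_cases hw' : w' ∈ edgeVerts L
  · obtain ⟨b, L', h', hv, hcol, hl'⟩ := h.exists_cons hw'
    rw [hv] at hw
    rw [hcol] at hc
    push Not at hw hc
    exact (HasRainbowForest.of_matching_path h' hww hw.2.1 hw.2.2 hc.1 hc.2).mono (by omega)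
  · refine .of_matching_add_two hcard ⟨(w, w') :: L, ⟨?_, ?_⟩, by simp [hl]⟩
    · simp [hw, hw', hww, h.1]
    · simp [hc, h.2]

end extension

section normalForm

variable {ι ρ : Type*}

/-- The color of the `i`-th edge of the canonical matching on `ι × Bool ⊕ ρ`. -/
def pairColor (c : Sym2 (ι × Bool ⊕ ρ) → ℕ) (i : ι) : ℕ :=
  c s(Sum.inl (i, false), Sum.inl (i, true))

lemma color_pair (c : Sym2 (ι × Bool ⊕ ρ) → ℕ) (i : ι) (a : Bool) :
    c s(Sum.inl (i, a), Sum.inl (i, !a)) = pairColor c i := by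
  cases a
  · rfl
  · exact congrArg c Sym2.eq_swap

lemma usedColors_comp {V W : Type*} [Fintype V] [DecidableEq V] [Fintype W] [DecidableEq W]
    (c : Sym2 V → ℕ) (e : W ≃ V) : usedColors (c ∘ Sym2.map e) = usedColors c := by
  ext k
  rw [mem_usedColors, mem_usedColors]
  constructor
  · rintro ⟨a, b, hab, rfl⟩
    exact ⟨e a, e b, e.injective.ne hab, rfl⟩
  · rintro ⟨a, b, hab, rfl⟩
    exact ⟨e.symm a, e.symm b, e.symm.injective.ne hab, by simp⟩

lemma edgeVerts_getElem_eq {V : Type*} {L : List (V × V)} (h : (edgeVerts L).Nodup)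
    {i j : ℕ} (hi : i < L.length) (hj : j < L.length) {v : V}
    (hvi : v = L[i].1 ∨ v = L[i].2) (hvj : v = L[j].1 ∨ v = L[j].2) : i = j := by
  unfold edgeVerts at h
  rw [List.nodup_flatMap] at h
  by_contra hne
  rcases lt_or_gt_of_ne hne with hlt | hlt
  · have := List.pairwise_iff_getElem.1 h.2 i j hi hj hlt
    simp [Function.onFun, List.Disjoint] at this
    grind
  · have := List.pairwise_iff_getElem.1 h.2 j i hj hi hlt
    simp [Function.onFun, List.Disjoint] at this
    grind

/-- A rainbow matching can be moved to the canonical position. -/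
lemma HasRainbowMatching.exists_equiv {V : Type*} [Fintype V] [DecidableEq V] {c : Sym2 V → ℕ}
    {k : ℕ} (h : HasRainbowMatching c k) :
    ∃ (s : Finset V) (e : Fin k × Bool ⊕ s ≃ V),
      Function.Injective (pairColor (c ∘ Sym2.map e)) ∧
      s.card + 2 * k = Fintype.card V := by
  obtain ⟨L, ⟨h1, h2⟩, rfl⟩ := h
  let f : Fin L.length × Bool → V := fun x => if x.2 then (L[x.1]).2 else (L[x.1]).1
  have hne : ∀ i : Fin L.length, (L[i]).1 ≠ (L[i]).2 := by
    intro i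
    unfold edgeVerts at h1
    rw [List.nodup_flatMap] at h1
    simpa using h1.1 L[i] (List.getElem_mem _)
  have hf : Function.Injective f := by
    rintro ⟨i, a⟩ ⟨j, b⟩ hij
    have hij' : i = j := by
      apply Fin.ext
      refine edgeVerts_getElem_eq h1 i.2 j.2 (v := f (i, a)) ?_ ?_
      · cases a <;> simp [f]
      · rw [hij]; cases b <;> simp [f]
    subst hij'
    have := hne i
    cases a <;> cases b <;> simp [f] at hij ⊢ <;> simp_all
  let s : Finset V := (Finset.univ.image f)ᶜ
  let e₀ : Fin L.length × Bool ≃ {x // x ∈ Finset.univ.image f} :=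
    (Equiv.ofInjective f hf).trans (Equiv.subtypeEquivRight (by simp))
  let e : Fin L.length × Bool ⊕ s ≃ V :=
    (Equiv.sumCongr e₀ (Equiv.subtypeEquivRight (by simp [s]))).trans
      (Equiv.sumCompl (fun x => x ∈ Finset.univ.image f))
  have he : ∀ x, e (Sum.inl x) = f x := fun x => rfl
  refine ⟨s, e, ?_, ?_⟩
  · intro i j hij
    simp only [pairColor, Function.comp, Sym2.map_mk, he, f] at hij
    unfold edgeColors at h2
    have := (List.nodup_iff_injective_get.1 h2) (a₁ := i.cast (by simp)) (a₂ := j.cast (by simp))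
      (by simpa using hij)
    simpa [Fin.ext_iff] using this
  · have := Fintype.card_congr e
    simp at this
    omega

/-- `E` is a set of edges with pairwise distinct colors, none of which appears on the canonical
matching. -/
structure IsNewEdgeSet (c : Sym2 (ι × Bool ⊕ ρ) → ℕ) (E : Finset (Sym2 (ι × Bool ⊕ ρ))) :
    Prop where
  injOn : Set.InjOn c E
  notMem : ∀ e ∈ E, ∀ i, c e ≠ pairColor c i
  not_isDiag : ∀ e ∈ E, ¬ e.IsDiag

lemma IsNewEdgeSet.isRainbowMatching {c : Sym2 (ι × Bool ⊕ ρ) → ℕ}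
    {E : Finset (Sym2 (ι × Bool ⊕ ρ))} (hE : IsNewEdgeSet c E)
    {L : List ((ι × Bool ⊕ ρ) × (ι × Bool ⊕ ρ))} (hL : ∀ p ∈ L, s(p.1, p.2) ∈ E)
    (hv : (edgeVerts L).Nodup) : IsRainbowMatching c L := by
  refine ⟨hv, ?_⟩
  induction L with
  | nil => simp
  | cons p L ih =>
    simp only [edgeVerts_cons, List.nodup_cons, List.mem_cons, not_or] at hv
    simp only [List.mem_cons, forall_eq_or_imp] at hL
    rw [edgeColors_cons, List.nodup_cons]
    refine ⟨?_, ih hL.2 hv.2.2⟩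
    intro h
    obtain ⟨q, hq, hqc⟩ := mem_edgeColors.1 h
    have := hE.injOn (hL.2 q hq) hL.1 hqc
    have hp : p.1 ∈ s(q.1, q.2) := by rw [this]; simp
    exact hv.1.2 (mem_edgeVerts.2 ⟨q, hq, by simpa using hp⟩)

variable [Fintype ι] [DecidableEq ι]

/-- The canonical edges whose index is outside `I`. -/
noncomputable def restEdges (ρ : Type*) (I : Finset ι) :
    List ((ι × Bool ⊕ ρ) × (ι × Bool ⊕ ρ)) :=
  Iᶜ.toList.map fun i => (Sum.inl (i, false), Sum.inl (i, true))

@[simp] lemma inl_mem_edgeVerts_restEdges {I : Finset ι} {i : ι} {a : Bool} :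
    Sum.inl (i, a) ∈ edgeVerts (restEdges ρ I) ↔ i ∉ I := by
  rw [mem_edgeVerts]
  constructor
  · rintro ⟨p, hp, h⟩
    simp only [restEdges, List.mem_map, Finset.mem_toList, Finset.mem_compl] at hp
    obtain ⟨j, hj, rfl⟩ := hp
    simp at h
    rcases h with h | h <;> exact h.1 ▸ hj
  · intro h
    refine ⟨(Sum.inl (i, false), Sum.inl (i, true)), ?_, ?_⟩
    · simp only [restEdges, List.mem_map, Finset.mem_toList, Finset.mem_compl]
      exact ⟨i, h, rfl⟩
    · cases a <;> simp

@[simp] lemma inr_notMem_edgeVerts_restEdges {I : Finset ι} {r : ρ} :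
    Sum.inr r ∉ edgeVerts (restEdges ρ I) := by
  rw [mem_edgeVerts]
  rintro ⟨p, hp, h⟩
  simp only [restEdges, List.mem_map] at hp
  obtain ⟨j, hj, rfl⟩ := hp
  simp at h

@[simp] lemma mem_edgeColors_restEdges {c : Sym2 (ι × Bool ⊕ ρ) → ℕ} {I : Finset ι} {k : ℕ} :
    k ∈ edgeColors c (restEdges ρ I) ↔ ∃ i, i ∉ I ∧ pairColor c i = k := by
  simp [restEdges, edgeColors, pairColor]

@[simp] lemma length_restEdges {I : Finset ι} :
    (restEdges ρ I).length = Fintype.card ι - I.card := by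
  simp [restEdges, Finset.card_compl]

lemma isRainbowMatching_restEdges {c : Sym2 (ι × Bool ⊕ ρ) → ℕ}
    (hc : Function.Injective (pairColor c)) (I : Finset ι) :
    IsRainbowMatching c (restEdges ρ I) := by
  have hn := Iᶜ.nodup_toList
  constructor
  · unfold edgeVerts restEdges
    rw [List.nodup_flatMap]
    constructor
    · simp
    · rw [List.pairwise_map]
      refine hn.imp ?_
      intro a b hab
      simp [Function.onFun, Ne.symm hab]
  · unfold edgeColors restEdges
    rw [List.map_map]
    exact hn.map hc

/-- Replace the canonical edges with index in `I` by the edges of `L`. -/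
lemma IsRainbowMatching.append_restEdges {c : Sym2 (ι × Bool ⊕ ρ) → ℕ}
    (hc : Function.Injective (pairColor c)) {I : Finset ι}
    {L : List ((ι × Bool ⊕ ρ) × (ι × Bool ⊕ ρ))} (hL : IsRainbowMatching c L)
    (hv : ∀ i a, Sum.inl (i, a) ∈ edgeVerts L → i ∈ I)
    (hcol : ∀ i ∉ I, pairColor c i ∉ edgeColors c L) :
    IsRainbowMatching c (L ++ restEdges ρ I) := by
  have hr := isRainbowMatching_restEdges hc I
  constructor
  · rw [edgeVerts_append, List.nodup_append']
    refine ⟨hL.1, hr.1, ?_⟩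
    rintro (⟨i, a⟩ | r) h1 h2
    · exact (inl_mem_edgeVerts_restEdges.1 h2) (hv i a h1)
    · exact inr_notMem_edgeVerts_restEdges h2
  · rw [edgeColors_append, List.nodup_append']
    refine ⟨hL.2, hr.2, ?_⟩
    intro k h1 h2
    obtain ⟨i, hi, rfl⟩ := mem_edgeColors_restEdges.1 h2
    exact hcol i hi h1

/-- Replace canonical edges by new edges. -/
lemma IsNewEdgeSet.append_restEdges {c : Sym2 (ι × Bool ⊕ ρ) → ℕ}
    {E : Finset (Sym2 (ι × Bool ⊕ ρ))} (hE : IsNewEdgeSet c E)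
    (hc : Function.Injective (pairColor c)) (I : Finset ι)
    (L : List ((ι × Bool ⊕ ρ) × (ι × Bool ⊕ ρ))) (hL : ∀ p ∈ L, s(p.1, p.2) ∈ E)
    (hv : (edgeVerts L).Nodup) (hI : ∀ i a, Sum.inl (i, a) ∈ edgeVerts L → i ∈ I) :
    IsRainbowMatching c (L ++ restEdges ρ I) := by
  refine (hE.isRainbowMatching hL hv).append_restEdges hc hI ?_
  intro i _ h
  obtain ⟨p, hp, hpc⟩ := mem_edgeColors.1 h
  exact hE.notMem _ (hL p hp) i hpc

/-- Replace canonical edges by new edges and one edge repeating a removed color. -/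
lemma IsNewEdgeSet.cons_append_restEdges {c : Sym2 (ι × Bool ⊕ ρ) → ℕ}
    {E : Finset (Sym2 (ι × Bool ⊕ ρ))} (hE : IsNewEdgeSet c E)
    (hc : Function.Injective (pairColor c)) (I : Finset ι)
    (f : (ι × Bool ⊕ ρ) × (ι × Bool ⊕ ρ))
    (L : List ((ι × Bool ⊕ ρ) × (ι × Bool ⊕ ρ))) {j : ι} (hj : j ∈ I)
    (hf : c s(f.1, f.2) = pairColor c j) (hL : ∀ p ∈ L, s(p.1, p.2) ∈ E)
    (hv : (edgeVerts (f :: L)).Nodup)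
    (hI : ∀ i a, Sum.inl (i, a) ∈ edgeVerts (f :: L) → i ∈ I) :
    IsRainbowMatching c (f :: L ++ restEdges ρ I) := by
  have hv' : (edgeVerts L).Nodup := by
    simp only [edgeVerts_cons, List.nodup_cons] at hv; exact hv.2.2
  refine IsRainbowMatching.append_restEdges hc ⟨hv, ?_⟩ hI ?_
  · rw [edgeColors_cons, List.nodup_cons]
    refine ⟨?_, (hE.isRainbowMatching hL hv').2⟩
    intro h
    obtain ⟨p, hp, hpc⟩ := mem_edgeColors.1 h
    exact hE.notMem _ (hL p hp) j (hpc.trans hf)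
  · intro i hi h
    rw [edgeColors_cons, List.mem_cons] at h
    rcases h with h | h
    · exact hi (hc (h.trans hf) ▸ hj)
    · obtain ⟨p, hp, hpc⟩ := mem_edgeColors.1 h
      exact hE.notMem _ (hL p hp) i hpc

/-- Representatives of all colors in a set of colors of edges satisfying `p`, none of them a
color of the canonical matching. -/
lemma exists_isNewEdgeSet [Fintype ρ] [DecidableEq ρ] (c : Sym2 (ι × Bool ⊕ ρ) → ℕ)
    (hc : Function.Injective (pairColor c))
    (p : Sym2 (ι × Bool ⊕ ρ) → Prop)
    (hp : ∀ e : Sym2 (ι × Bool ⊕ ρ), ¬ e.IsDiag → (∀ i, c e ≠ pairColor c i) →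
      ∃ e', ¬ e'.IsDiag ∧ p e' ∧ c e' = c e) :
    ∃ E, IsNewEdgeSet c E ∧ (∀ e ∈ E, p e) ∧
      (usedColors c).card = E.card + Fintype.card ι ∧
      ∀ k ∈ usedColors c, (∀ i, k ≠ pairColor c i) → ∃ e ∈ E, c e = k := by
  classical
  let T : Finset (Sym2 (ι × Bool ⊕ ρ)) :=
    Finset.univ.filter fun e => ¬ e.IsDiag ∧ p e ∧ ∀ i, c e ≠ pairColor c i
  obtain ⟨E, hET, hEi, hEc⟩ := Finset.exists_subset_injOn_image_eq_of_surjOn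
    (f := c) T (T.image c) (by rw [Finset.coe_image]; exact Set.surjOn_image c T)
  have hmem : ∀ e ∈ E, ¬ e.IsDiag ∧ p e ∧ ∀ i, c e ≠ pairColor c i := fun e he => by
    simpa [T] using hET he
  have hcov : ∀ k ∈ usedColors c, (∀ i, k ≠ pairColor c i) → ∃ e ∈ E, c e = k := by
    intro k hk hki
    obtain ⟨a, b, hab, rfl⟩ := mem_usedColors.1 hk
    obtain ⟨e', h1, h2, h3⟩ := hp s(a, b) (by simpa using hab) hki
    have : c e' ∈ E.image c := by
      rw [hEc]
      refine Finset.mem_image_of_mem _ ?_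
      simp only [T, Finset.mem_filter, Finset.mem_univ, true_and]
      exact ⟨h1, h2, by rwa [h3]⟩
    obtain ⟨e, he, hce⟩ := Finset.mem_image.1 this
    exact ⟨e, he, hce.trans h3⟩
  refine ⟨E, ⟨hEi, fun e he => (hmem e he).2.2, fun e he => (hmem e he).1⟩,
    fun e he => (hmem e he).2.1, ?_, hcov⟩
  have hU : usedColors c = E.image c ∪ Finset.univ.image (pairColor c) := by
    ext k
    simp only [Finset.mem_union, Finset.mem_image, Finset.mem_univ, true_and]
    constructor
    · intro hk
      by_cases h : ∃ i, pairColor c i = k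
      · exact Or.inr h
      · push Not at h
        exact Or.inl (hcov k hk fun i => (h i).symm)
    · rintro (⟨e, he, rfl⟩ | ⟨i, rfl⟩)
      · exact Finset.mem_image_of_mem _ (by simpa using (hmem e he).1)
      · exact mem_usedColors.2 ⟨_, _, by simp, rfl⟩
  rw [hU, Finset.card_union_of_disjoint, Finset.card_image_of_injOn hEi,
    Finset.card_image_of_injective _ hc, Finset.card_univ]
  rw [Finset.disjoint_left]
  intro k h1 h2
  obtain ⟨e, he, rfl⟩ := Finset.mem_image.1 h1
  obtain ⟨i, -, hi⟩ := Finset.mem_image.1 h2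
  exact (hmem e he).2.2 i hi.symm

end normalForm

section augmentation

variable {ι ρ : Type*} [Fintype ι] [DecidableEq ι] {c : Sym2 (ι × Bool ⊕ ρ) → ℕ}
  {E : Finset (Sym2 (ι × Bool ⊕ ρ))}

/-- A set of new edges in a coloring for which the canonical matching is a maximum rainbow
matching. -/
structure IsMaximal (c : Sym2 (ι × Bool ⊕ ρ) → ℕ) (E : Finset (Sym2 (ι × Bool ⊕ ρ))) : Prop
    extends IsNewEdgeSet c E where
  injective : Function.Injective (pairColor c)
  not_hasRainbowMatching : ¬ HasRainbowMatching c (Fintype.card ι + 1)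

namespace IsMaximal

lemma not_augment (h : IsMaximal c E) (I : Finset ι)
    (L : List ((ι × Bool ⊕ ρ) × (ι × Bool ⊕ ρ))) (hlen : L.length = I.card + 1)
    (hL : ∀ p ∈ L, s(p.1, p.2) ∈ E) (hv : (edgeVerts L).Nodup) :
    ¬ ∀ i a, Sum.inl (i, a) ∈ edgeVerts L → i ∈ I := fun hI =>
  h.not_hasRainbowMatching ⟨_, h.append_restEdges h.injective I L hL hv hI, by
    have := Finset.card_le_univ I
    rw [List.length_append, length_restEdges]; omega⟩

lemma not_augment_cons (h : IsMaximal c E) (I : Finset ι)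
    (f : (ι × Bool ⊕ ρ) × (ι × Bool ⊕ ρ)) (L : List ((ι × Bool ⊕ ρ) × (ι × Bool ⊕ ρ))) {j : ι}
    (hf : c s(f.1, f.2) = pairColor c j) (hlen : L.length = I.card) (hj : j ∈ I)
    (hL : ∀ p ∈ L, s(p.1, p.2) ∈ E) (hv : (edgeVerts (f :: L)).Nodup) :
    ¬ ∀ i a, Sum.inl (i, a) ∈ edgeVerts (f :: L) → i ∈ I := fun hI =>
  h.not_hasRainbowMatching ⟨_, h.cons_append_restEdges h.injective I f L hj hf hL hv hI, by
    have := Finset.card_le_univ I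
    rw [List.length_append, length_restEdges, List.length_cons]; omega⟩

lemma exists_pairColor (h : IsMaximal c E) {r r' : ρ} (hr : r ≠ r') :
    ∃ j, c s(Sum.inr r, Sum.inr r') = pairColor c j := by
  by_contra! hc
  refine h.not_hasRainbowMatching ⟨_, IsRainbowMatching.append_restEdges h.injective (I := ∅)
    (L := [(Sum.inr r, Sum.inr r')]) ⟨by simp [hr], by simp⟩ (by simp) ?_, by simp⟩
  intro i _
  simpa using (hc i).symm

lemma inr_inr_notMem (h : IsMaximal c E) (r r' : ρ) : s(Sum.inr r, Sum.inr r') ∉ E := by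
  intro he
  have hr : r ≠ r' := by rintro rfl; exact h.not_isDiag _ he (by simp)
  obtain ⟨j, hj⟩ := h.exists_pairColor hr
  exact h.notMem _ he j hj

variable {i i' j : ι} {a a' b : Bool} {r r' r'' : ρ}

lemma inr_eq_of_mem_of_not_mem (h : IsMaximal c E) (h1 : s(Sum.inl (i, a), Sum.inr r) ∈ E)
    (h2 : s(Sum.inl (i, !a), Sum.inr r') ∈ E) : r = r' := by
  by_contra hr
  refine h.not_augment {i} [(Sum.inl (i, a), Sum.inr r), (Sum.inl (i, !a), Sum.inr r')]
    (by simp) (by simp [h1, h2]) (by simp [hr]) ?_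
  intro k d
  simp
  grind

lemma mem_or_mem_of_color (h : IsMaximal c E) (hr : r ≠ r')
    (hj : c s(Sum.inr r, Sum.inr r') = pairColor c j)
    (h1 : s(Sum.inl (j, a), Sum.inr r'') ∈ E) : r'' = r ∨ r'' = r' := by
  by_contra! hne
  refine h.not_augment_cons {j} (Sum.inr r, Sum.inr r') [(Sum.inl (j, a), Sum.inr r'')]
    hj (by simp) (by simp) (by simp [h1]) (by simp [hr, hne.1.symm, hne.2.symm]) ?_
  intro k d
  simp
  grind

lemma not_path_to_color (h : IsMaximal c E) (hr : r ≠ r') (hij : i ≠ j)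
    (hj : c s(Sum.inr r, Sum.inr r') = pairColor c j)
    (h1 : s(Sum.inl (i, a), Sum.inr r'') ∈ E) (hr1 : r'' ≠ r) (hr2 : r'' ≠ r') :
    s(Sum.inl (i, !a), Sum.inl (j, b)) ∉ E := by
  intro h2
  refine h.not_augment_cons {i, j} (Sum.inr r, Sum.inr r')
    [(Sum.inl (i, a), Sum.inr r''), (Sum.inl (i, !a), Sum.inl (j, b))]
    hj (by simp [hij]) (by simp) (by simp [h1, h2])
    (by simp [hr, hr1.symm, hr2.symm, hij]) ?_
  intro k d
  simp
  grind

lemma not_star_star (h : IsMaximal c E) (hij : i ≠ i') (hr : r ≠ r')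
    (h1 : s(Sum.inl (i, a), Sum.inr r) ∈ E) (h2 : s(Sum.inl (i', a'), Sum.inr r') ∈ E) :
    s(Sum.inl (i, !a), Sum.inl (i', !a')) ∉ E := by
  intro h3
  refine h.not_augment {i, i'} [(Sum.inl (i, a), Sum.inr r), (Sum.inl (i', a'), Sum.inr r'),
    (Sum.inl (i, !a), Sum.inl (i', !a'))] (by simp [hij]) (by simp [h1, h2, h3])
    (by simp [hr, hij, Ne.symm hij]) ?_
  intro k d
  simp
  grind

lemma eq_of_crossing (h : IsMaximal c E) (hij : i ≠ j) (hij' : i' ≠ j) (hr : r ≠ r')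
    (h1 : s(Sum.inl (i, a), Sum.inr r) ∈ E) (h2 : s(Sum.inl (i', a'), Sum.inr r') ∈ E)
    (h3 : s(Sum.inl (i, !a), Sum.inl (j, b)) ∈ E)
    (h4 : s(Sum.inl (i', !a'), Sum.inl (j, !b)) ∈ E) : i = i' := by
  by_contra hii
  refine h.not_augment {i, i', j} [(Sum.inl (i, a), Sum.inr r), (Sum.inl (i', a'), Sum.inr r'),
    (Sum.inl (i, !a), Sum.inl (j, b)), (Sum.inl (i', !a'), Sum.inl (j, !b))]
    (by simp [hij, hij', hii]) (by simp [h1, h2, h3, h4])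
    (by simp [hr, hij, hij', hii, Ne.symm hij', Ne.symm hii]) ?_
  intro k d
  simp
  grind

lemma not_alternating_path (h : IsMaximal c E) (hij : i ≠ j) (hr : r ≠ r')
    (h1 : s(Sum.inl (i, a), Sum.inr r) ∈ E) (h2 : s(Sum.inl (i, !a), Sum.inl (j, b)) ∈ E) :
    s(Sum.inl (j, !b), Sum.inr r') ∉ E := by
  intro h3
  refine h.not_augment {i, j} [(Sum.inl (i, a), Sum.inr r),
    (Sum.inl (i, !a), Sum.inl (j, b)), (Sum.inl (j, !b), Sum.inr r')]
    (by simp [hij]) (by simp [h1, h2, h3]) (by simp [hr, hij]) ?_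
  intro k d
  simp
  grind

lemma not_alternating_cycle (h : IsMaximal c E) (hr : r ≠ r') (hij : i ≠ j)
    (hj : c s(Sum.inr r, Sum.inr r') = pairColor c j)
    (h1 : s(Sum.inl (i, a), Sum.inl (j, b)) ∈ E) :
    s(Sum.inl (i, !a), Sum.inl (j, !b)) ∉ E := by
  intro h2
  refine h.not_augment_cons {i, j} (Sum.inr r, Sum.inr r')
    [(Sum.inl (i, a), Sum.inl (j, b)), (Sum.inl (i, !a), Sum.inl (j, !b))]
    hj (by simp [hij]) (by simp) (by simp [h1, h2])
    (by simp [hr, hij, Ne.symm hij]) ?_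
  intro k d
  simp
  grind

end IsMaximal

end augmentation

section counting

variable {ι ρ : Type*} [DecidableEq ι] [DecidableEq ρ]

/-- The number of edges in `E` between the `i`-th and the `j`-th canonical edge. -/
def pairDegree (E : Finset (Sym2 (ι × Bool ⊕ ρ))) (i j : ι) : ℕ :=
  ∑ a : Bool, ∑ b : Bool, if s(Sum.inl (i, a), Sum.inl (j, b)) ∈ E then 1 else 0

/-- The number of edges in `E` between the `i`-th canonical edge and the remaining vertices. -/
def restDegree [Fintype ρ] (E : Finset (Sym2 (ι × Bool ⊕ ρ))) (i : ι) : ℕ :=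
  ∑ a : Bool, ∑ r : ρ, if s(Sum.inl (i, a), Sum.inr r) ∈ E then 1 else 0

lemma pairDegree_comm (E : Finset (Sym2 (ι × Bool ⊕ ρ))) (i j : ι) :
    pairDegree E i j = pairDegree E j i := by
  unfold pairDegree
  rw [Finset.sum_comm]
  simp only [Sym2.eq_swap]

lemma pairDegree_eq (E : Finset (Sym2 (ι × Bool ⊕ ρ))) (i j : ι) (a : Bool) :
    pairDegree E i j =
      (∑ b, if s(Sum.inl (i, a), Sum.inl (j, b)) ∈ E then 1 else 0) +
      ∑ b, if s(Sum.inl (i, !a), Sum.inl (j, b)) ∈ E then 1 else 0 := by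
  cases a <;> simp [pairDegree, add_comm]

lemma pairDegree_le_four (E : Finset (Sym2 (ι × Bool ⊕ ρ))) (i j : ι) :
    pairDegree E i j ≤ 4 := by
  simp only [pairDegree, Fintype.sum_bool]
  split_ifs <;> simp

lemma pairDegree_self {c : Sym2 (ι × Bool ⊕ ρ) → ℕ} {E : Finset (Sym2 (ι × Bool ⊕ ρ))}
    (hE : IsNewEdgeSet c E) (i : ι) : pairDegree E i i = 0 := by
  have h : ∀ a b, s(Sum.inl (i, a), Sum.inl (i, b)) ∉ E := by
    intro a b he
    by_cases hab : b = a
    · subst hab; exact hE.not_isDiag _ he (by simp)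
    · obtain rfl : b = !a := by cases a <;> cases b <;> simp_all
      exact hE.notMem _ he i (color_pair c i a)
  simp [pairDegree, h]

variable [Fintype ι] [Fintype ρ]

lemma two_mul_card_eq {c : Sym2 (ι × Bool ⊕ ρ) → ℕ} {E : Finset (Sym2 (ι × Bool ⊕ ρ))}
    (hE : IsNewEdgeSet c E) (hr : ∀ r r' : ρ, s(Sum.inr r, Sum.inr r') ∉ E) :
    2 * E.card = ∑ i, ∑ j, pairDegree E i j + 2 * ∑ i, restDegree E i := by
  classical
  have key : 2 * E.card = ∑ u, ∑ v, if s(u, v) ∈ E then 1 else 0 := by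
    let G : SimpleGraph (ι × Bool ⊕ ρ) := SimpleGraph.fromEdgeSet E
    have hG : G.edgeFinset = E := by
      ext e
      simp only [mem_edgeFinset, G, edgeSet_fromEdgeSet]
      simpa using hE.not_isDiag e
    have hdeg : ∀ u, G.degree u = ∑ v, if s(u, v) ∈ E then 1 else 0 := by
      intro u
      rw [← card_neighborFinset_eq_degree, Finset.sum_boole, Nat.cast_id]
      congr 1
      ext v
      simp only [mem_neighborFinset, G, fromEdgeSet_adj, Finset.mem_filter, Finset.mem_univ,
        true_and, Finset.mem_coe, and_iff_left_iff_imp]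
      rintro he rfl
      exact hE.not_isDiag _ he (by simp)
    rw [← Finset.sum_congr rfl fun u _ => hdeg u, ← hG]
    convert G.sum_degrees_eq_twice_card_edges.symm
  rw [key]
  simp only [Fintype.sum_sum_type, Fintype.sum_prod_type, hr, if_false, Finset.sum_const_zero,
    add_zero, Finset.sum_add_distrib, pairDegree, restDegree]
  have h1 : ∀ i : ι, ∑ a : Bool, ∑ j : ι, ∑ b : Bool,
      (if s((Sum.inl (i, a) : ι × Bool ⊕ ρ), Sum.inl (j, b)) ∈ E then 1 else 0) =
      ∑ j : ι, ∑ a : Bool, ∑ b : Bool,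
      (if s((Sum.inl (i, a) : ι × Bool ⊕ ρ), Sum.inl (j, b)) ∈ E then 1 else 0) :=
    fun i => Finset.sum_comm
  have h2 : ∑ r : ρ, ∑ i : ι, ∑ a : Bool,
      (if s((Sum.inr r : ι × Bool ⊕ ρ), Sum.inl (i, a)) ∈ E then 1 else 0) =
      ∑ i : ι, ∑ a : Bool, ∑ r : ρ,
      (if s((Sum.inl (i, a) : ι × Bool ⊕ ρ), Sum.inr r) ∈ E then 1 else 0) := by
    rw [Finset.sum_comm]
    refine Finset.sum_congr rfl fun i _ => ?_
    rw [Finset.sum_comm]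
    refine Finset.sum_congr rfl fun a _ => Finset.sum_congr rfl fun r _ => ?_
    rw [Sym2.eq_swap]
  rw [h2]
  simp only [h1]
  ring

end counting

lemma sum_sum_le {ι : Type*} {D : ι → ι → ℕ} {A B : Finset ι} {b : ℕ}
    (h : ∀ i ∈ A, ∀ j ∈ B, D i j ≤ b) :
    ∑ i ∈ A, ∑ j ∈ B, D i j ≤ b * (A.card * B.card) := by
  calc ∑ i ∈ A, ∑ j ∈ B, D i j ≤ ∑ i ∈ A, B.card * b :=
        Finset.sum_le_sum fun i hi => Finset.sum_le_card_nsmul _ _ _ (h i hi)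
    _ = b * (A.card * B.card) := by rw [Finset.sum_const, smul_eq_mul]; ring

lemma mul_pred_add_self (a : ℕ) : a * (a - 1) + a = a * a := by
  cases a <;> simp [mul_add]

lemma two_mul_lt_of_le_one {p n m e : ℕ} (hA : 2 * (p + n) * (p + n + 1) + 2 ≤ e)
    (h : 2 * e ≤ 3 * (p * (p - 1)) + 2 * (p * m) + 4 * (n * (n - 1)) + 2 * (n * (3 * p + 2)) +
      4 * (p * 1) + 4 * (n * 1) + (0 + 2 * 0)) :
    2 * e < (p + n) * (2 * m + 3 * (p + n) + 1) + 2 := by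
  by_contra! hB
  have hp := mul_pred_add_self p
  have hn := mul_pred_add_self n
  have h5 : p * p + 2 * n * p + 3 * p + 4 ≤ 2 * p * m := by linarith
  have h6 : 2 * n * m + 2 ≤ n * n + 3 * n := by linarith
  have h7 := Nat.mul_le_mul_left n h5
  have h8 := Nat.mul_le_mul_left p h6
  have h9 : 0 ≤ n * p * p := Nat.zero_le _
  have h10 : 0 ≤ n * n * p := Nat.zero_le _
  have hp0 : p = 0 := by linarith
  subst hp0
  linarith

lemma two_mul_lt_of_le_two {p n m e X : ℕ} (hA : 2 * (p + n + 1) * (p + n + 1 + 1) + 2 ≤ e)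
    (h : 2 * e ≤ 3 * (p * (p - 1)) + 2 * (p * m) + 4 * (n * (n - 1)) + 2 * (n * (3 * p + 2)) +
      4 * (p * 2) + 4 * (n * 2) + 2 * X) (hX : X ≤ 6) (hX' : p + n = 0 → X ≤ 5) :
    2 * e < (p + n + 1) * (2 * m + 3 * (p + n + 1) + 1) + 2 := by
  by_contra! hB
  have hp := mul_pred_add_self p
  have hn := mul_pred_add_self n
  have h5 : p * p + 2 * n * p + 7 * p + 4 * n ≤ 2 * p * m := by linarith
  have h6 : 2 * m * (n + 1) + 2 * p ≤ n * n + n + 6 := by linarith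
  have h7 := Nat.mul_le_mul_left (n + 1) h5
  have h8 := Nat.mul_le_mul_left p h6
  have h9 : 0 ≤ n * p * p := Nat.zero_le _
  have h10 : 0 ≤ n * n * p := Nat.zero_le _
  have h11 : 0 ≤ n * n := Nat.zero_le _
  have h12 : 0 ≤ p * p := Nat.zero_le _
  have h13 : 0 ≤ n * p := Nat.zero_le _
  have hp0 : p = 0 := by linarith
  subst hp0
  have hn0 : n = 0 := by linarith
  subst hn0
  have := hX' rfl
  linarith

section extension

variable {ι ρ : Type*} [DecidableEq ι] [DecidableEq ρ]
  {c : Sym2 (ι × Bool ⊕ ρ) → ℕ} {E : Finset (Sym2 (ι × Bool ⊕ ρ))}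

lemma sum_sum_self_le {D : ι → ι → ℕ} {A : Finset ι} {b : ℕ} (h0 : ∀ i ∈ A, D i i = 0)
    (h : ∀ i ∈ A, ∀ j ∈ A, i ≠ j → D i j ≤ b) :
    ∑ i ∈ A, ∑ j ∈ A, D i j ≤ b * (A.card * (A.card - 1)) := by
  calc ∑ i ∈ A, ∑ j ∈ A, D i j ≤ ∑ i ∈ A, (A.card - 1) * b := by
        refine Finset.sum_le_sum fun i hi => ?_
        rw [← Finset.add_sum_erase _ _ hi, h0 i hi, zero_add, ← Finset.card_erase_of_mem hi]
        refine Finset.sum_le_card_nsmul _ _ _ fun j hj => ?_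
        exact h i hi j (Finset.mem_of_mem_erase hj) (Finset.ne_of_mem_erase hj).symm
    _ = b * (A.card * (A.card - 1)) := by rw [Finset.sum_const, smul_eq_mul]; ring

lemma IsMaximal.pairDegree_le_two [Fintype ι] {i j : ι} {r r' : ρ}
    (h : IsMaximal c E) (hr : r ≠ r') (hij : i ≠ j)
    (hj : c s(Sum.inr r, Sum.inr r') = pairColor c j) : pairDegree E i j ≤ 2 := by
  have h1 := fun a b => h.not_alternating_cycle (a := a) (b := b) hr hij hj
  have h00 := h1 false false
  have h01 := h1 false true
  simp only [Bool.not_true, Bool.not_false] at h00 h01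
  simp only [pairDegree, Fintype.sum_bool]
  split_ifs <;> simp_all

variable [Fintype ρ]

/-- The neighbors in `E` of an end of the `i`-th canonical edge among the remaining vertices. -/
def restNeighbors (E : Finset (Sym2 (ι × Bool ⊕ ρ))) (i : ι) (a : Bool) : Finset ρ :=
  Finset.univ.filter fun r => s(Sum.inl (i, a), Sum.inr r) ∈ E

@[simp] lemma mem_restNeighbors {i : ι} {a : Bool} {r : ρ} :
    r ∈ restNeighbors E i a ↔ s(Sum.inl (i, a), Sum.inr r) ∈ E := by
  simp [restNeighbors]

lemma restDegree_eq (E : Finset (Sym2 (ι × Bool ⊕ ρ))) (i : ι) (a : Bool) :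
    restDegree E i = (restNeighbors E i a).card + (restNeighbors E i (!a)).card := by
  cases a <;> simp [restDegree, restNeighbors, Finset.sum_boole, add_comm]

lemma forall_mem_of_two_le_restDegree {i : ι} {r : ρ} (hi : 2 ≤ restDegree E i)
    (h : ∀ a r', s(Sum.inl (i, a), Sum.inr r') ∈ E → r' = r) (a : Bool) :
    s(Sum.inl (i, a), Sum.inr r) ∈ E := by
  by_contra ha
  have h1 : restNeighbors E i a = ∅ := by
    ext r'
    simp only [mem_restNeighbors, Finset.notMem_empty, iff_false]
    intro hr'
    exact ha (h a r' hr' ▸ hr')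
  have h2 : (restNeighbors E i (!a)).card ≤ 1 := by
    refine Finset.card_le_one.2 fun x hx y hy => ?_
    rw [h _ x (mem_restNeighbors.1 hx), h _ y (mem_restNeighbors.1 hy)]
  rw [restDegree_eq E i a, h1, Finset.card_empty] at hi
  omega

variable [Fintype ι]

namespace IsMaximal

variable {i i' j : ι} {r r' : ρ}

lemma exists_side (h : IsMaximal c E) (hi : 3 ≤ restDegree E i) :
    ∃ a, restDegree E i = (restNeighbors E i a).card := by
  by_contra! hne
  have hpos : ∀ a, (restNeighbors E i a).Nonempty := by
    intro a
    rw [← Finset.card_pos]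
    have := hne (!a)
    rw [restDegree_eq E i a] at this
    omega
  have hle : ∀ a, (restNeighbors E i a).card ≤ 1 := by
    intro a
    obtain ⟨r, hr⟩ := hpos (!a)
    refine Finset.card_le_one.2 fun x hx y hy => ?_
    rw [h.inr_eq_of_mem_of_not_mem (mem_restNeighbors.1 hx) (mem_restNeighbors.1 hr),
      h.inr_eq_of_mem_of_not_mem (mem_restNeighbors.1 hy) (mem_restNeighbors.1 hr)]
  have := hle true
  have := hle false
  have := restDegree_eq E i true
  simp only [Bool.not_true] at this
  omega

lemma exists_side_forall (h : IsMaximal c E) (hi : 3 ≤ restDegree E i) :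
    ∃ a, ∀ r r', ∃ r'', r'' ≠ r ∧ r'' ≠ r' ∧ s(Sum.inl (i, a), Sum.inr r'') ∈ E := by
  obtain ⟨a, ha⟩ := h.exists_side hi
  refine ⟨a, fun r r' => ?_⟩
  have hc : ({r, r'} : Finset ρ).card < (restNeighbors E i a).card :=
    lt_of_le_of_lt Finset.card_le_two (by omega)
  obtain ⟨x, hx, hx'⟩ := Finset.exists_mem_notMem_of_card_lt_card hc
  simp only [Finset.mem_insert, Finset.mem_singleton, not_or] at hx'
  exact ⟨x, hx'.1, hx'.2, mem_restNeighbors.1 hx⟩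

lemma restDegree_le (h : IsMaximal c E) (hi : 3 ≤ restDegree E i) :
    restDegree E i ≤ Fintype.card ρ := by
  obtain ⟨a, ha⟩ := h.exists_side hi
  exact ha ▸ Finset.card_le_univ _

lemma restDegree_le_two (h : IsMaximal c E) (hr : r ≠ r')
    (hj : c s(Sum.inr r, Sum.inr r') = pairColor c j) : restDegree E j ≤ 2 := by
  by_contra! hlt
  obtain ⟨a, ha⟩ := h.exists_side_forall hlt
  obtain ⟨x, h1, h2, h3⟩ := ha r r'
  rcases h.mem_or_mem_of_color hr hj h3 with h4 | h4
  · exact h1 h4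
  · exact h2 h4

lemma pairDegree_le_three (h : IsMaximal c E) (hij : i ≠ i') (hi : 3 ≤ restDegree E i)
    (hi' : 3 ≤ restDegree E i') : pairDegree E i i' ≤ 3 := by
  obtain ⟨a, ha⟩ := h.exists_side_forall hi
  obtain ⟨a', ha'⟩ := h.exists_side_forall hi'
  by_contra! hlt
  have hne : s(Sum.inl (i, !a), Sum.inl (i', !a')) ∉ E := by
    obtain ⟨r₀⟩ : Nonempty ρ := by
      by_contra hne
      rw [not_nonempty_iff] at hne
      simp [restDegree] at hi
    obtain ⟨r, -, -, h1⟩ := ha r₀ r₀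
    obtain ⟨r', h2, -, h3⟩ := ha' r r
    exact h.not_star_star hij h2.symm h1 h3
  revert hlt
  rw [imp_false, not_lt]
  simp only [pairDegree, Fintype.sum_bool]
  cases a <;> cases a' <;> simp only [Bool.not_true, Bool.not_false] at hne <;>
    split_ifs <;> simp_all

lemma restDegree_add_sum_le (h : IsMaximal c E) {P : Finset ι}
    (hP : ∀ i ∈ P, 3 ≤ restDegree E i) (hjP : j ∉ P) (hj : restDegree E j ≤ 2) :
    restDegree E j + ∑ i ∈ P, pairDegree E i j ≤ 3 * P.card + 2 := by
  have hside : ∀ i : ι, ∃ a, i ∈ P →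
      ∀ r r', ∃ r'', r'' ≠ r ∧ r'' ≠ r' ∧ s(Sum.inl (i, a), Sum.inr r'') ∈ E := by
    intro i
    by_cases hi : i ∈ P
    · obtain ⟨a, ha⟩ := h.exists_side_forall (hP i hi)
      exact ⟨a, fun _ => ha⟩
    · exact ⟨true, fun h => absurd h hi⟩
  choose a ha using hside
  let Y : Bool → Finset ι := fun b => P.filter fun i => s(Sum.inl (i, !a i), Sum.inl (j, b)) ∈ E
  have hD : ∀ i, pairDegree E i j ≤ 2 + ∑ b,
      if s(Sum.inl (i, !a i), Sum.inl (j, b)) ∈ E then 1 else 0 := by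
    intro i
    rw [pairDegree_eq E i j (a i)]
    gcongr
    simp only [Fintype.sum_bool]
    split_ifs <;> simp
  have hsum : ∑ i ∈ P, pairDegree E i j ≤ 2 * P.card + ((Y true).card + (Y false).card) := by
    refine (Finset.sum_le_sum fun i _ => hD i).trans ?_
    rw [Finset.sum_add_distrib, Finset.sum_const, smul_eq_mul, mul_comm]
    rw [Finset.sum_comm]
    simp [Finset.sum_boole, Y]
  have hYP : ∀ b, (Y b).card ≤ P.card := fun b => Finset.card_filter_le _ _
  have hmem : ∀ b i, i ∈ Y b → i ∈ P ∧ s(Sum.inl (i, !a i), Sum.inl (j, b)) ∈ E := fun b i hi => by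
    simpa [Y] using hi
  rcases (Y true).eq_empty_or_nonempty with ht | ⟨i₁, h1⟩
  · have := hYP false
    rw [ht, Finset.card_empty] at hsum
    omega
  rcases (Y false).eq_empty_or_nonempty with hf | ⟨i₂, h2⟩
  · have := hYP true
    rw [hf, Finset.card_empty] at hsum
    omega
  have hS : ∀ b, restNeighbors E j b = ∅ := by
    intro b
    obtain ⟨i, hi⟩ : (Y (!b)).Nonempty := by
      cases b
      · exact ⟨i₁, h1⟩
      · exact ⟨i₂, h2⟩
    obtain ⟨hiP, hi⟩ := hmem _ _ hi
    ext r
    simp only [mem_restNeighbors, Finset.notMem_empty, iff_false]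
    intro hr
    obtain ⟨r', h3, -, h4⟩ := ha i hiP r r
    have hij : i ≠ j := by rintro rfl; exact hjP hiP
    refine h.not_alternating_path hij h3 h4 hi ?_
    rwa [Bool.not_not]
  have heq : ∀ x ∈ Y true, ∀ y ∈ Y false, x = y := by
    intro x hx y hy
    obtain ⟨hxP, hx⟩ := hmem _ _ hx
    obtain ⟨hyP, hy⟩ := hmem _ _ hy
    obtain ⟨r₀⟩ : Nonempty ρ := by
      by_contra hne
      rw [not_nonempty_iff] at hne
      have := hP x hxP
      simp [restDegree] at this
    obtain ⟨r, -, -, h3⟩ := ha x hxP r₀ r₀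
    obtain ⟨r', h4, -, h5⟩ := ha y hyP r r
    exact h.eq_of_crossing (by rintro rfl; exact hjP hxP) (by rintro rfl; exact hjP hyP)
      h4.symm h3 h5 hx hy
  have hY1 : (Y true).card ≤ 1 := Finset.card_le_one.2 fun x hx y hy => by
    rw [heq x hx i₂ h2, heq y hy i₂ h2]
  have hY2 : (Y false).card ≤ 1 := Finset.card_le_one.2 fun x hx y hy => by
    rw [← heq i₁ h1 x hx, ← heq i₁ h1 y hy]
  have h0 := restDegree_eq E j true
  rw [hS, hS, Finset.card_empty] at h0
  omega

end IsMaximal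

namespace IsMaximal

/-- The bound on the number of new edges in terms of the canonical edges which have at least three
neighbors outside the canonical matching, and a set `J` of canonical edges whose colors
appear outside of it. -/
lemma two_mul_card_le (h : IsMaximal c E) {P N J : Finset ι} (hPN : Disjoint P N)
    (hPJ : Disjoint (P ∪ N) J) (huniv : P ∪ N ∪ J = Finset.univ)
    (hP : ∀ i ∈ P, 3 ≤ restDegree E i) (hN : ∀ i ∈ N, restDegree E i ≤ 2)
    (hJ : ∀ j ∈ J, ∃ r r', r ≠ r' ∧ c s(Sum.inr r, Sum.inr r') = pairColor c j) :
    2 * E.card ≤ 3 * (P.card * (P.card - 1)) + 2 * (P.card * Fintype.card ρ) +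
      4 * (N.card * (N.card - 1)) + 2 * (N.card * (3 * P.card + 2)) +
      4 * (P.card * J.card) + 4 * (N.card * J.card) +
      (∑ i ∈ J, ∑ j ∈ J, pairDegree E i j + 2 * ∑ j ∈ J, restDegree E j) := by
  have hself := pairDegree_self h.toIsNewEdgeSet
  have hJ2 : ∀ i, ∀ j ∈ J, i ≠ j → pairDegree E i j ≤ 2 := fun i j hj hij => by
    obtain ⟨r, r', hr, hc⟩ := hJ j hj
    exact h.pairDegree_le_two hr hij hc
  have hsplit : ∀ f : ι → ℕ, ∑ i, f i = ∑ i ∈ P, f i + ∑ i ∈ N, f i + ∑ i ∈ J, f i := by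
    intro f
    rw [← huniv, Finset.sum_union hPJ, Finset.sum_union hPN]
  have hcomm : ∀ A B : Finset ι,
      ∑ i ∈ A, ∑ j ∈ B, pairDegree E i j = ∑ i ∈ B, ∑ j ∈ A, pairDegree E i j := by
    intro A B
    rw [Finset.sum_comm]
    simp only [pairDegree_comm E]
  rw [two_mul_card_eq h.toIsNewEdgeSet h.inr_inr_notMem]
  simp only [hsplit, Finset.sum_add_distrib]
  rw [hcomm N P, hcomm J P, hcomm J N]
  have hdis : ∀ i ∈ P ∪ N, ∀ j ∈ J, i ≠ j := fun i hi j hj => by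
    rintro rfl; exact Finset.disjoint_left.1 hPJ hi hj
  have hPP := sum_sum_self_le (A := P) (b := 3) (fun i _ => hself i) fun i hi j hj hij =>
    h.pairDegree_le_three hij (hP i hi) (hP j hj)
  have hNN := sum_sum_self_le (A := N) (b := 4) (fun i _ => hself i) fun i _ j _ _ =>
    pairDegree_le_four E i j
  have hPJ' := sum_sum_le (A := P) (B := J) (b := 2) fun i hi j hj =>
    hJ2 i j hj (hdis i (Finset.mem_union_left _ hi) j hj)
  have hNJ' := sum_sum_le (A := N) (B := J) (b := 2) fun i hi j hj =>
    hJ2 i j hj (hdis i (Finset.mem_union_right _ hi) j hj)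
  have hPS : ∑ i ∈ P, restDegree E i ≤ P.card * Fintype.card ρ :=
    Finset.sum_le_card_nsmul _ _ _ fun i hi => h.restDegree_le (hP i hi)
  have hPN' : ∑ j ∈ N, restDegree E j + ∑ i ∈ P, ∑ j ∈ N, pairDegree E i j ≤
      N.card * (3 * P.card + 2) := by
    rw [Finset.sum_comm, ← Finset.sum_add_distrib]
    exact Finset.sum_le_card_nsmul _ _ _ fun j hj =>
      h.restDegree_add_sum_le hP (Finset.disjoint_right.1 hPN hj) (hN j hj)
  linarith

lemma restDegree_add_pairDegree_le (h : IsMaximal c E) {r r' r'' : ρ} {j j' : ι}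
    (hr : r ≠ r') (hr' : r ≠ r'') (hr'' : r' ≠ r'') (hjj : j ≠ j')
    (hj : c s(Sum.inr r, Sum.inr r') = pairColor c j)
    (hj' : c s(Sum.inr r', Sum.inr r'') = pairColor c j')
    (huniv : ∀ i, i = j ∨ i = j') :
    restDegree E j + restDegree E j' + pairDegree E j j' ≤ 5 := by
  have h1 := h.restDegree_le_two hr hj
  have h2 := h.restDegree_le_two hr'' hj'
  have h3 := h.pairDegree_le_two hr'' hjj hj'
  by_contra! hlt
  suffices pairDegree E j j' = 0 by omega
  by_cases hb : ∃ b, s(Sum.inl (j, b), Sum.inr r') ∈ E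
  · obtain ⟨b, hb⟩ := hb
    obtain ⟨i, hi⟩ := h.exists_pairColor hr'
    have hij : i ≠ j := by
      rintro rfl
      rcases h.mem_or_mem_of_color hr' hi hb with h4 | h4
      · exact hr h4.symm
      · exact hr'' h4
    obtain rfl : i = j' := (huniv i).resolve_left hij
    have h4 := forall_mem_of_two_le_restDegree (E := E) (i := i) (r := r'') (by omega) (by
      intro _ x hx
      have := h.mem_or_mem_of_color hr' hi hx
      have := h.mem_or_mem_of_color hr'' hj' hx
      grind)
    have h5 : ∀ d b, s(Sum.inl (i, d), Sum.inl (j, b)) ∉ E := by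
      intro d b
      have := h.not_path_to_color (b := b) hr hij hj (h4 (!d)) hr'.symm hr''.symm
      rwa [Bool.not_not] at this
    rw [pairDegree_comm]
    simp [pairDegree, h5]
  · push Not at hb
    have h4 := forall_mem_of_two_le_restDegree (E := E) (i := j) (r := r) (by omega) (by
      intro a x hx
      rcases h.mem_or_mem_of_color hr hj hx with rfl | rfl
      · rfl
      · exact absurd hx (hb a))
    have h5 : ∀ d b, s(Sum.inl (j, d), Sum.inl (j', b)) ∉ E := by
      intro d b
      have := h.not_path_to_color (b := b) hr'' hjj hj' (h4 (!d)) hr hr'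
      rwa [Bool.not_not] at this
    simp [pairDegree, h5]

/-- If the canonical matching of size `s + 1` is a maximum rainbow matching, there are only few
colors. -/
lemma card_lt (h : IsMaximal c E) (hm : 3 ≤ Fintype.card ρ) {s : ℕ} (hs : Fintype.card ι = s + 1)
    (hA : 2 * s * (s + 1) + 2 ≤ E.card) :
    2 * E.card < s * (2 * Fintype.card ρ + 3 * s + 1) + 2 := by
  by_contra! hB
  obtain ⟨r, r', hr⟩ := Fintype.exists_pair_of_one_lt_card (by omega : 1 < Fintype.card ρ)
  obtain ⟨j, hj⟩ := h.exists_pairColor hr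
  obtain ⟨P, hPmem⟩ : ∃ P : Finset ι, ∀ i, i ∈ P ↔ 3 ≤ restDegree E i :=
    ⟨Finset.univ.filter fun i => 3 ≤ restDegree E i, by simp⟩
  have hsplit : ∀ J : Finset ι, (∀ j ∈ J, restDegree E j ≤ 2) →
      Disjoint P (Pᶜ \ J) ∧ Disjoint (P ∪ Pᶜ \ J) J ∧ P ∪ Pᶜ \ J ∪ J = Finset.univ ∧
      ∀ i ∈ Pᶜ \ J, restDegree E i ≤ 2 := by
    intro J hJ
    have hJP : ∀ j ∈ J, j ∉ P := fun j hj hjP => by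
      have := hJ j hj
      have := (hPmem j).1 hjP
      omega
    refine ⟨?_, ?_, ?_, ?_⟩
    · rw [Finset.disjoint_left]
      simp only [Finset.mem_sdiff, Finset.mem_compl]
      tauto
    · rw [Finset.disjoint_left]
      simp only [Finset.mem_union, Finset.mem_sdiff, Finset.mem_compl]
      intro i hi hiJ
      exact hi.elim (hJP i hiJ) fun h => h.2 hiJ
    · ext i
      simp only [Finset.mem_union, Finset.mem_sdiff, Finset.mem_compl, Finset.mem_univ, iff_true]
      tauto
    · intro i hi
      have : i ∉ P := by simpa using (Finset.mem_sdiff.1 hi).1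
      rw [hPmem] at this
      omega
  have hj2 := h.restDegree_le_two hr hj
  rcases Nat.eq_zero_or_pos (restDegree E j) with hj0 | hjpos
  · obtain ⟨h1, h2, h3, h4⟩ := hsplit {j} (by simpa using hj2)
    have key := h.two_mul_card_le h1 h2 h3 (fun i hi => (hPmem i).1 hi) h4
      (by simpa using ⟨r, r', hr, hj⟩)
    have hcard := congrArg Finset.card h3
    rw [Finset.card_union_of_disjoint h2, Finset.card_union_of_disjoint h1, Finset.card_univ,
      hs, Finset.card_singleton] at hcard
    simp only [Finset.sum_singleton, pairDegree_self h.toIsNewEdgeSet, hj0,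
      Finset.card_singleton] at key
    obtain rfl : s = P.card + (Pᶜ \ {j}).card := by omega
    exact lt_irrefl _ (two_mul_lt_of_le_one hA key |>.trans_le hB)
  · obtain ⟨a, x, hx⟩ : ∃ a x, s(Sum.inl (j, a), Sum.inr x) ∈ E := by
      by_contra! hne
      simp [restDegree, hne] at hjpos
    obtain ⟨y, hxy, hj⟩ : ∃ y, x ≠ y ∧ c s(Sum.inr x, Sum.inr y) = pairColor c j := by
      rcases h.mem_or_mem_of_color hr hj hx with rfl | rfl
      · exact ⟨_, hr, hj⟩
      · exact ⟨_, hr.symm, by rwa [Sym2.eq_swap]⟩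
    obtain ⟨z, hz⟩ : ∃ z, z ∉ ({x, y} : Finset ρ) := by
      by_contra! hne
      have := Finset.card_le_two (a := x) (b := y)
      rw [Finset.eq_univ_iff_forall.2 hne, Finset.card_univ] at this
      omega
    simp only [Finset.mem_insert, Finset.mem_singleton, not_or] at hz
    obtain ⟨j', hj'⟩ := h.exists_pairColor (Ne.symm hz.2)
    have hjj : j ≠ j' := by
      rintro rfl
      rcases h.mem_or_mem_of_color (Ne.symm hz.2) hj' hx with h4 | h4
      · exact hxy h4
      · exact hz.1 h4.symm
    have hj2' := h.restDegree_le_two (Ne.symm hz.2) hj'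
    have hD := h.pairDegree_le_two (Ne.symm hz.2) hjj hj'
    obtain ⟨h1, h2, h3, h4⟩ := hsplit {j, j'} (by simp [hj2, hj2'])
    have key := h.two_mul_card_le h1 h2 h3 (fun i hi => (hPmem i).1 hi) h4
      (by simpa using ⟨⟨x, y, hxy, hj⟩, y, z, Ne.symm hz.2, hj'⟩)
    have hcard := congrArg Finset.card h3
    rw [Finset.card_union_of_disjoint h2, Finset.card_union_of_disjoint h1, Finset.card_univ,
      hs, Finset.card_pair hjj] at hcard
    simp only [Finset.sum_pair hjj, pairDegree_self h.toIsNewEdgeSet, Finset.card_pair hjj,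
      pairDegree_comm E j' j] at key
    have hspec : P.card + (Pᶜ \ {j, j'}).card = 0 →
        restDegree E j + restDegree E j' + pairDegree E j j' ≤ 5 := by
      intro h0
      refine h.restDegree_add_pairDegree_le hxy (Ne.symm hz.1) (Ne.symm hz.2) hjj hj hj' ?_
      intro i
      have hi : i ∈ P ∪ Pᶜ \ {j, j'} ∪ {j, j'} := by rw [h3]; simp
      have hP0 : P = ∅ := Finset.card_eq_zero.1 (by omega)
      have hN0 : Pᶜ \ {j, j'} = ∅ := Finset.card_eq_zero.1 (by omega)
      rw [hN0, hP0] at hi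
      simpa using hi
    obtain rfl : s = P.card + (Pᶜ \ {j, j'}).card + 1 := by omega
    refine lt_irrefl _ (two_mul_lt_of_le_two (X := restDegree E j + restDegree E j' +
      pairDegree E j j') hA (by linarith) (by omega) hspec |>.trans_le hB)

end IsMaximal

end extension

section largeMatching

lemma hasRainbowMatching_one {V : Type*} [Fintype V] {c : Sym2 V → ℕ} (h : 2 ≤ Fintype.card V) :
    HasRainbowMatching c 1 := by
  obtain ⟨x, y, hxy⟩ := Fintype.exists_pair_of_one_lt_card h
  exact ⟨[(x, y)], ⟨by simp [hxy], by simp⟩, rfl⟩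

variable {V : Type*} [Fintype V] [DecidableEq V] {c : Sym2 V → ℕ}

lemma HasRainbowMatching.succ {s : ℕ} (h : HasRainbowMatching c (s + 1))
    (hn : 2 * (s + 1) + 3 ≤ Fintype.card V) (hA : (s + 1) * (2 * s + 1) + 2 ≤ (usedColors c).card)
    (hB : s * (2 * Fintype.card V) + 4 ≤ 2 * (usedColors c).card + s * (s + 1)) :
    HasRainbowMatching c (s + 2) := by
  obtain ⟨R, e, hinj, hcard⟩ := h.exists_equiv
  by_contra hno
  obtain ⟨E, hE, -, hK, -⟩ := exists_isNewEdgeSet (c ∘ Sym2.map e) hinj (fun _ => True)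
    fun f hf _ => ⟨f, hf, trivial, rfl⟩
  have hmax : IsMaximal (c ∘ Sym2.map e) E := ⟨hE, hinj, fun h' => hno (by
    simpa using h'.of_comp e.injective)⟩
  rw [usedColors_comp, Fintype.card_fin] at hK
  rw [hK] at hA hB
  rw [← hcard] at hn hB
  have := hmax.card_lt (by rw [Fintype.card_coe]; omega) (Fintype.card_fin _)
    (by linarith)
  rw [Fintype.card_coe] at this
  linarith

/-- Sufficiently many colors force a large rainbow matching. -/
lemma hasRainbowMatching_of_card {u : ℕ} (hn : 2 * (u + 1) + 3 ≤ Fintype.card V)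
    (hA : (u + 1) * (2 * u + 1) + 2 ≤ (usedColors c).card)
    (hB : u * (2 * Fintype.card V) + 4 ≤ 2 * (usedColors c).card + u * (u + 1)) :
    HasRainbowMatching c (u + 2) := by
  suffices ∀ s ≤ u + 1, HasRainbowMatching c (s + 1) from this (u + 1) le_rfl
  intro s hs
  induction s with
  | zero => exact hasRainbowMatching_one (by omega)
  | succ s ih =>
    obtain ⟨d, rfl⟩ : ∃ d, u = s + d := Nat.exists_eq_add_of_le (by omega)
    refine (ih (by omega)).succ (by omega) (by nlinarith) ?_
    have : d * (2 * s + d + 1) ≤ d * (2 * Fintype.card V) := Nat.mul_le_mul_left _ (by omega)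
    linarith

end largeMatching

section rainbowClique

variable {V : Type*} {c : Sym2 V → ℕ}

lemma IsRainbowMatching.fst_ne_snd {L : List (V × V)} (h : IsRainbowMatching c L) {p : V × V}
    (hp : p ∈ L) : p.1 ≠ p.2 := by
  have h1 := h.1
  unfold edgeVerts at h1
  rw [List.nodup_flatMap] at h1
  simpa using h1.1 p hp

lemma IsRainbowMatching.color_eq {L : List (V × V)} {k : ℕ} (hk : k ∈ edgeColors c L)
    (hL : IsRainbowMatching c L) :
    ∃ a ∈ edgeVerts L, ∃ b ∈ edgeVerts L, a ≠ b ∧ c s(a, b) = k := by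
  obtain ⟨p, hp, hpc⟩ := mem_edgeColors.1 hk
  exact ⟨p.1, mem_edgeVerts.2 ⟨p, hp, Or.inl rfl⟩, p.2, mem_edgeVerts.2 ⟨p, hp, Or.inr rfl⟩,
    hL.fst_ne_snd hp, hpc⟩

/-- The edges inside `Q` have pairwise distinct colors. -/
def IsRainbowOn (c : Sym2 V → ℕ) (Q : Finset V) : Prop :=
  ∀ a ∈ Q, ∀ b ∈ Q, ∀ a' ∈ Q, ∀ b' ∈ Q, a ≠ b → a' ≠ b' → c s(a, b) = c s(a', b') →
    s(a, b) = s(a', b')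

lemma IsRainbowOn.mono {Q Q' : Finset V} (h : IsRainbowOn c Q) (hQ : Q' ⊆ Q) : IsRainbowOn c Q' :=
  fun a ha b hb a' ha' b' hb' =>
    h a (hQ ha) b (hQ hb) a' (hQ ha') b' (hQ hb')

variable [DecidableEq V]

lemma IsRainbowOn.exists_matching {k : ℕ} : ∀ {Q : Finset V}, IsRainbowOn c Q → Q.card = 2 * k →
    ∃ L, IsRainbowMatching c L ∧ L.length = k ∧ ∀ v ∈ edgeVerts L, v ∈ Q := by
  induction k with
  | zero => exact fun _ _ => ⟨[], ⟨by simp, by simp⟩, rfl, by simp⟩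
  | succ k ih =>
    intro Q hQ hcard
    obtain ⟨a, ha, b, hb, hab⟩ := Finset.one_lt_card.1 (by omega : 1 < Q.card)
    have hb' : b ∈ Q.erase a := Finset.mem_erase.2 ⟨hab.symm, hb⟩
    have hsub : (Q.erase a).erase b ⊆ Q :=
      (Finset.erase_subset _ _).trans (Finset.erase_subset _ _)
    obtain ⟨L, h1, h2, h3⟩ := ih (hQ.mono hsub) (by
      rw [Finset.card_erase_of_mem hb', Finset.card_erase_of_mem ha]; omega)
    have ha' : a ∉ edgeVerts L := fun h => by simpa using h3 a h
    have hb'' : b ∉ edgeVerts L := fun h => by simpa using h3 b h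
    refine ⟨(a, b) :: L, ⟨by simp [hab, ha', hb'', h1.1], ?_⟩, by simp [h2], ?_⟩
    · rw [edgeColors_cons, List.nodup_cons]
      refine ⟨fun h => ?_, h1.2⟩
      obtain ⟨p, hp, hpc⟩ := mem_edgeColors.1 h
      have hp1 : p.1 ∈ edgeVerts L := mem_edgeVerts.2 ⟨p, hp, Or.inl rfl⟩
      have hp2 : p.2 ∈ edgeVerts L := mem_edgeVerts.2 ⟨p, hp, Or.inr rfl⟩
      have := hQ _ (hsub (h3 _ hp1)) _ (hsub (h3 _ hp2)) a ha b hb (h1.fst_ne_snd hp) hab hpc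
      have ha'' : a ∈ s(p.1, p.2) := by rw [this]; simp
      exact ha' (mem_edgeVerts.2 ⟨p, hp, by simpa using ha''⟩)
    · intro v hv
      simp only [edgeVerts_cons, List.mem_cons] at hv
      rcases hv with rfl | rfl | hv
      · exact ha
      · exact hb
      · exact hsub (h3 v hv)

/-- Two vertices of a rainbow clique, such that no other edge has a prescribed color. -/
lemma IsRainbowOn.exists_pair {Q : Finset V} (hQ : IsRainbowOn c Q) (hcard : 2 ≤ Q.card) (κ : ℕ) :
    ∃ p ∈ Q, ∃ q ∈ Q, p ≠ q ∧
      ∀ a ∈ Q, ∀ b ∈ Q, a ≠ b → c s(a, b) = κ → s(a, b) = s(p, q) := by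
  by_cases h : ∃ p ∈ Q, ∃ q ∈ Q, p ≠ q ∧ c s(p, q) = κ
  · obtain ⟨p, hp, q, hq, hpq, hc⟩ := h
    exact ⟨p, hp, q, hq, hpq, fun a ha b hb hab h =>
      hQ a ha b hb p hp q hq hab hpq (h.trans hc.symm)⟩
  · push Not at h
    obtain ⟨p, hp, q, hq, hpq⟩ := Finset.one_lt_card.1 hcard
    exact ⟨p, hp, q, hq, hpq, fun a ha b hb hab hc => absurd hc (h a ha b hb hab)⟩

lemma HasRainbowForest.of_isRainbowOn {Q : Finset V} {t : ℕ} (ht : 2 ≤ t)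
    (hQ : IsRainbowOn c Q) (hcard : Q.card = 2 * t) {u w x y : V} (hu : u ∉ Q) (hw : w ∉ Q)
    (hy : y ∉ Q) (hx : x ∈ Q) (huw : u ≠ w) (huy : u ≠ y) (hwy : w ≠ y)
    (hne : c s(x, y) ≠ c s(u, y))
    (hQ' : ∀ a ∈ Q, ∀ b ∈ Q, a ≠ b → c s(a, b) ≠ c s(x, y) ∧ c s(a, b) ≠ c s(u, y)) :
    HasRainbowForest c t := by
  by_cases hκ : c s(u, w) = c s(x, y)
  · obtain ⟨L, h1, h2, h3⟩ := hQ.exists_matching hcard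
    have hmem : ∀ {v}, v ∉ Q → v ∉ edgeVerts L := fun hv h => hv (h3 _ h)
    have hcol : ∀ k ∈ edgeColors c L, k ≠ c s(x, y) ∧ k ≠ c s(u, y) := by
      intro k hk
      obtain ⟨a, ha, b, hb, hab, rfl⟩ := h1.color_eq hk
      exact hQ' a (h3 a ha) b (h3 b hb) hab
    refine ⟨y, u, w, L, ?_, ?_, h2⟩
    · simp [hmem hu, hmem hw, hmem hy, huw, huy.symm, hwy.symm, h1.1]
    · rw [Sym2.eq_swap, hκ]
      have := fun h => (hcol _ h).1 rfl
      have := fun h => (hcol _ h).2 rfl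
      simp_all [h1.2, Ne.symm hne]
  · have hcard1 : (Q.erase x).card = 2 * t - 1 := by rw [Finset.card_erase_of_mem hx, hcard]
    have hQx := hQ.mono (Finset.erase_subset x Q)
    obtain ⟨p, hp, q, hq, hpq, hpq'⟩ := hQx.exists_pair (by omega) (c s(u, w))
    obtain ⟨m, hm, hm'⟩ := Finset.exists_mem_notMem_of_card_lt_card
      (s := {p, q}) (t := Q.erase x) (Finset.card_le_two.trans_lt (by omega))
    simp only [Finset.mem_insert, Finset.mem_singleton, not_or] at hm'
    have hmpq : {p, m, q} ⊆ Q.erase x := by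
      intro v hv
      simp only [Finset.mem_insert, Finset.mem_singleton] at hv
      rcases hv with rfl | rfl | rfl <;> assumption
    have hcard2 : (Q.erase x \ {p, m, q}).card = 2 * (t - 2) := by
      rw [Finset.card_sdiff_of_subset hmpq, hcard1, Finset.card_eq_three.2
        ⟨p, m, q, Ne.symm hm'.1, hpq, hm'.2, rfl⟩]
      omega
    have hsub : Q.erase x \ {p, m, q} ⊆ Q.erase x := Finset.sdiff_subset
    obtain ⟨L, h1, h2, h3⟩ := (hQx.mono hsub).exists_matching hcard2
    have h4 : ∀ v ∈ edgeVerts L, v ∈ Q ∧ v ≠ x ∧ v ≠ p ∧ v ≠ m ∧ v ≠ q := by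
      intro v hv
      have := h3 v hv
      simp only [Finset.mem_sdiff, Finset.mem_erase, Finset.mem_insert, Finset.mem_singleton,
        not_or] at this
      tauto
    have hpQ := Finset.mem_erase.1 hp
    have hqQ := Finset.mem_erase.1 hq
    have hmQ := Finset.mem_erase.1 hm
    have hcol : ∀ k ∈ edgeColors c L, k ≠ c s(x, y) ∧ k ≠ c s(u, w) ∧ k ≠ c s(p, m) ∧
        k ≠ c s(m, q) := by
      intro k hk
      obtain ⟨a, ha, b, hb, hab, rfl⟩ := h1.color_eq hk
      obtain ⟨ha1, ha2, ha3, ha4, ha5⟩ := h4 a ha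
      obtain ⟨hb1, hb2, hb3, hb4, hb5⟩ := h4 b hb
      refine ⟨(hQ' a ha1 b hb1 hab).1, fun h => ?_, fun h => ?_, fun h => ?_⟩
      · have := hpq' a (Finset.mem_erase.2 ⟨ha2, ha1⟩) b (Finset.mem_erase.2 ⟨hb2, hb1⟩) hab h
        simp [ha3, ha5] at this
      · have := hQ a ha1 b hb1 p hpQ.2 m hmQ.2 hab (Ne.symm hm'.1) h
        simp [ha3, ha4] at this
      · have := hQ a ha1 b hb1 m hmQ.2 q hqQ.2 hab hm'.2 h
        simp [ha4, ha5] at this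
    have hpm : c s(p, m) ≠ c s(u, w) := fun h => by
      have := hpq' p hp m hm (Ne.symm hm'.1) h
      simp [hpq, hm'.2] at this
    have hmq : c s(m, q) ≠ c s(u, w) := fun h => by
      have := hpq' m hm q hq hm'.2 h
      simp [hm'.1, hm'.2] at this
    have hpmq : c s(p, m) ≠ c s(m, q) := fun h => by
      have := hQ p hpQ.2 m hmQ.2 m hmQ.2 q hqQ.2 (Ne.symm hm'.1) hm'.2 h
      simp [hpq, Ne.symm hm'.1] at this
    refine ⟨p, m, q, (x, y) :: (u, w) :: L, ?_, ?_, by simp [h2]; omega⟩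
    · have hn : ∀ {v}, v ∉ Q → v ∉ edgeVerts L := fun hv h => hv (h4 _ h).1
      have hxL : x ∉ edgeVerts L := fun h => (h4 _ h).2.1 rfl
      have hpL : p ∉ edgeVerts L := fun h => (h4 _ h).2.2.1 rfl
      have hmL : m ∉ edgeVerts L := fun h => (h4 _ h).2.2.2.1 rfl
      have hqL : q ∉ edgeVerts L := fun h => (h4 _ h).2.2.2.2 rfl
      have hd : ∀ {v z}, v ∈ Q → z ∉ Q → v ≠ z := fun hv hz h => hz (h ▸ hv)
      simp [h1.1, hn hu, hn hw, hn hy, hxL, hpL, hmL, hqL, hpq, hm'.2, Ne.symm hm'.1, hpQ.1,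
        hmQ.1, hqQ.1, huw, Ne.symm huy, Ne.symm hwy, hd hpQ.2 hu, hd hpQ.2 hw, hd hpQ.2 hy,
        hd hmQ.2 hu, hd hmQ.2 hw, hd hmQ.2 hy, hd hqQ.2 hu, hd hqQ.2 hw, hd hqQ.2 hy,
        hd hx hu, hd hx hw, hd hx hy]
    · have h5 : c s(x, y) ∉ edgeColors c L := fun h => (hcol _ h).1 rfl
      have h6 : c s(u, w) ∉ edgeColors c L := fun h => (hcol _ h).2.1 rfl
      have h7 : c s(p, m) ∉ edgeColors c L := fun h => (hcol _ h).2.2.1 rfl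
      have h8 : c s(m, q) ∉ edgeColors c L := fun h => (hcol _ h).2.2.2 rfl
      simp [h1.2, h5, h6, h7, h8, hpm, hmq, hpmq, Ne.symm hκ,
        (hQ' p hpQ.2 m hmQ.2 (Ne.symm hm'.1)).1, (hQ' m hmQ.2 q hqQ.2 hm'.2).1]

/-- If nearly all colors appear inside a small set, then this set is rainbow. -/
lemma isRainbowOn_of_card [Fintype V] {Q : Finset V} {t κ κ' : ℕ} (hcard : Q.card = 2 * t)
    (hK : 2 * t * t + 2 ≤ (usedColors c).card + t)
    (hcov : ∀ k ∈ usedColors c, k ≠ κ → k ≠ κ' → ∃ a ∈ Q, ∃ b ∈ Q, a ≠ b ∧ c s(a, b) = k) :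
    IsRainbowOn c Q ∧ ∀ a ∈ Q, ∀ b ∈ Q, a ≠ b → c s(a, b) ≠ κ ∧ c s(a, b) ≠ κ' := by
  let T : Finset (Sym2 V) := Q.offDiag.image Sym2.mk.uncurry
  have hT : T.card = (2 * t).choose 2 := by rw [Sym2.card_image_offDiag, hcard]
  have hT' : T.card + t = 2 * t * t := by
    have h1 : (2 * t).choose 2 = t * (2 * t - 1) := by
      rw [Nat.choose_two_right, mul_assoc, Nat.mul_div_cancel_left _ two_pos]
    rw [hT, h1]
    cases t with
    | zero => simp
    | succ t => rw [show 2 * (t + 1) - 1 = 2 * t + 1 by omega]; ring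
  have hTmem : ∀ a ∈ Q, ∀ b ∈ Q, a ≠ b → s(a, b) ∈ T := fun a ha b hb hab =>
    Finset.mem_image.2 ⟨(a, b), Finset.mem_offDiag.2 ⟨ha, hb, hab⟩, rfl⟩
  have hsub : usedColors c \ {κ, κ'} ⊆ T.image c := by
    intro k hk
    simp only [Finset.mem_sdiff, Finset.mem_insert, Finset.mem_singleton, not_or] at hk
    obtain ⟨a, ha, b, hb, hab, rfl⟩ := hcov k hk.1 hk.2.1 hk.2.2
    exact Finset.mem_image_of_mem c (hTmem a ha b hb hab)
  have hle : T.card ≤ (usedColors c \ {κ, κ'}).card := by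
    have h1 := Finset.le_card_sdiff {κ, κ'} (usedColors c)
    have h2 : ({κ, κ'} : Finset ℕ).card ≤ 2 := Finset.card_le_two
    omega
  have heq : usedColors c \ {κ, κ'} = T.image c :=
    Finset.eq_of_subset_of_card_le hsub (Finset.card_image_le.trans hle)
  have hinj : Set.InjOn c T := by
    rw [← Finset.card_image_iff, ← heq]
    exact le_antisymm (heq ▸ Finset.card_image_le) hle
  refine ⟨fun a ha b hb a' ha' b' hb' hab hab' h =>
    hinj (hTmem a ha b hb hab) (hTmem a' ha' b' hb' hab') h, fun a ha b hb hab => ?_⟩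
  have := Finset.mem_image_of_mem c (hTmem a ha b hb hab)
  rw [← heq] at this
  simpa using (Finset.mem_sdiff.1 this).2

end rainbowClique

section sideDegree

variable {ι ρ : Type*} [DecidableEq ι] [DecidableEq ρ]

/-- The number of edges in `E` between the vertex `x` and the `i`-th canonical edge. -/
def sideDegree (E : Finset (Sym2 (ι × Bool ⊕ ρ))) (x : ι × Bool ⊕ ρ) (i : ι) : ℕ :=
  ∑ a : Bool, if s(x, Sum.inl (i, a)) ∈ E then 1 else 0

lemma pairDegree_eq_sideDegree (E : Finset (Sym2 (ι × Bool ⊕ ρ))) (i j : ι) (a : Bool) :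
    pairDegree E i j = sideDegree E (Sum.inl (i, a)) j + sideDegree E (Sum.inl (i, !a)) j :=
  pairDegree_eq E i j a

lemma sideDegree_eq_zero {E : Finset (Sym2 (ι × Bool ⊕ ρ))} {x : ι × Bool ⊕ ρ} {i : ι}
    (h : ∀ a, s(x, Sum.inl (i, a)) ∉ E) : sideDegree E x i = 0 := by
  simp [sideDegree, h]

lemma two_mul_sideDegree_add_le {E : Finset (Sym2 (ι × Bool ⊕ ρ))} {x : ι × Bool ⊕ ρ} {i j : ι}
    (h : ∀ a b, s(x, Sum.inl (i, a)) ∈ E → s(Sum.inl (i, !a), Sum.inl (j, b)) ∉ E) :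
    2 * sideDegree E x i + pairDegree E i j ≤ 4 := by
  have key : ∀ a, 2 * (if s(x, Sum.inl (i, a)) ∈ E then 1 else 0) +
      ∑ b, (if s(Sum.inl (i, !a), Sum.inl (j, b)) ∈ E then 1 else 0) ≤ 2 := by
    intro a
    by_cases ha : s(x, Sum.inl (i, a)) ∈ E
    · simp [ha, h a _ ha]
    · rw [if_neg ha, Fintype.sum_bool]
      split_ifs <;> simp
  have h1 := key false
  have h2 := key true
  rw [Bool.not_false] at h1
  rw [Bool.not_true] at h2
  simp only [sideDegree, pairDegree, Fintype.sum_bool] at *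
  omega

end sideDegree

section forestFree

variable {ι ρ : Type*} [Fintype ι] [DecidableEq ι] [Fintype ρ] [DecidableEq ρ]

/-- A coloring with many colors and without a rainbow `P₃ ∪ tP₂`, for which the canonical
matching is a rainbow `(t + 1)`-matching. -/
structure IsForestFree (c : Sym2 (ι × Bool ⊕ ρ) → ℕ) (t : ℕ) : Prop where
  injective : Function.Injective (pairColor c)
  not_hasRainbowForest : ¬ HasRainbowForest c t
  card_eq : Fintype.card ι = t + 1
  two_le : 2 ≤ t
  le_card : 2 * t * t + 2 ≤ (usedColors c).card + t

namespace IsForestFree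

variable {c : Sym2 (ι × Bool ⊕ ρ) → ℕ} {t : ℕ} {E : Finset (Sym2 (ι × Bool ⊕ ρ))}

lemma mem_edgeColors (h : IsForestFree c t) {L : List ((ι × Bool ⊕ ρ) × (ι × Bool ⊕ ρ))}
    (hL : IsRainbowMatching c L) (hl : L.length = t + 1) {w w' : ι × Bool ⊕ ρ}
    (hw : w ∉ edgeVerts L) (hww : w ≠ w') : c s(w, w') ∈ edgeColors c L := by
  refine hL.mem_edgeColors_of_notMem ?_ h.not_hasRainbowForest hl hw hww
  have h1 := h.le_card
  have h2 := Nat.mul_le_mul_right t h.two_le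
  have h3 := h.two_le
  nlinarith

lemma exists_pairColor (h : IsForestFree c t) (u : ρ) {v : ι × Bool ⊕ ρ} (hv : Sum.inr u ≠ v) :
    ∃ j, c s(Sum.inr u, v) = pairColor c j := by
  have := h.mem_edgeColors (isRainbowMatching_restEdges h.injective ∅) (by simp [h.card_eq])
    inr_notMem_edgeVerts_restEdges hv
  obtain ⟨j, -, hj⟩ := mem_edgeColors_restEdges.1 this
  exact ⟨j, hj.symm⟩

lemma inr_notMem (h : IsForestFree c t) (hE : IsNewEdgeSet c E) (u : ρ) (v : ι × Bool ⊕ ρ) :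
    s(Sum.inr u, v) ∉ E := by
  intro he
  have hv : Sum.inr u ≠ v := by
    rintro rfl
    exact hE.not_isDiag _ he (by simp)
  obtain ⟨j, hj⟩ := h.exists_pairColor u hv
  exact hE.notMem _ he j hj

lemma false_of_sum_le (h : IsForestFree c t) (hE : IsNewEdgeSet c E)
    (hcard : (usedColors c).card = E.card + Fintype.card ι) {J : Finset ι} {m : ℕ}
    (hJ : J.card = m + 1)
    (h1 : ∑ i ∈ J, ∑ j ∈ J, pairDegree E i j ≤ 4 * (m * (m - 1)))
    (h2 : ∀ i ∉ J, ∑ j ∈ J, pairDegree E i j ≤ 4 * m) : False := by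
  have htot := two_mul_card_eq hE fun r r' => h.inr_notMem hE r (Sum.inr r')
  have hrest : ∑ i, restDegree E i = 0 := by
    refine Finset.sum_eq_zero fun i _ => ?_
    unfold restDegree
    refine Finset.sum_eq_zero fun a _ => Finset.sum_eq_zero fun r _ => if_neg ?_
    rw [Sym2.eq_swap]
    exact h.inr_notMem hE r _
  have hcross : ∑ i ∈ Jᶜ, ∑ j ∈ J, pairDegree E i j ≤ Jᶜ.card * (4 * m) :=
    Finset.sum_le_card_nsmul _ _ _ fun i hi => h2 i (Finset.mem_compl.1 hi)
  have hcross' : ∑ i ∈ J, ∑ j ∈ Jᶜ, pairDegree E i j = ∑ i ∈ Jᶜ, ∑ j ∈ J, pairDegree E i j := by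
    rw [Finset.sum_comm]
    simp only [pairDegree_comm E]
  have hcompl : ∑ i ∈ Jᶜ, ∑ j ∈ Jᶜ, pairDegree E i j ≤ 4 * (Jᶜ.card * (Jᶜ.card - 1)) :=
    sum_sum_self_le (fun i _ => pairDegree_self hE i) fun i _ j _ _ => pairDegree_le_four E i j
  have hsplit : ∑ i, ∑ j, pairDegree E i j =
      (∑ i ∈ J, ∑ j ∈ J, pairDegree E i j + ∑ i ∈ J, ∑ j ∈ Jᶜ, pairDegree E i j) +
      (∑ i ∈ Jᶜ, ∑ j ∈ J, pairDegree E i j + ∑ i ∈ Jᶜ, ∑ j ∈ Jᶜ, pairDegree E i j) := by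
    rw [← Finset.sum_add_sum_compl J, ← Finset.sum_add_distrib, ← Finset.sum_add_distrib]
    simp only [Finset.sum_add_sum_compl]
  have hn : Jᶜ.card + m = t := by
    have := Finset.card_compl_add_card J
    have := h.card_eq
    omega
  have hK := h.le_card
  have hι := h.card_eq
  generalize Jᶜ.card = n at *
  have hm' := mul_pred_add_self m
  have hn' := mul_pred_add_self n
  subst hn
  nlinarith

/-- All new colors can be represented by edges avoiding a vertex missed by some rainbow
`(t + 1)`-matching. -/
lemma exists_avoiding (h : IsForestFree c t) {w : ι × Bool ⊕ ρ}
    {L : List ((ι × Bool ⊕ ρ) × (ι × Bool ⊕ ρ))} (hL : IsRainbowMatching c L)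
    (hl : L.length = t + 1) (hw : w ∉ edgeVerts L) :
    ∃ E, IsNewEdgeSet c E ∧ (∀ e ∈ E, w ∉ e) ∧
      (usedColors c).card = E.card + Fintype.card ι ∧
      ∀ k ∈ usedColors c, (∀ i, k ≠ pairColor c i) → ∃ e ∈ E, c e = k := by
  refine exists_isNewEdgeSet c h.injective (fun e => w ∉ e) fun e he _ => ?_
  by_cases hwe : w ∈ e
  · obtain ⟨w', rfl⟩ := Sym2.mem_iff_exists.1 hwe
    obtain ⟨a, ha, b, hb, hab, hc⟩ :=
      hL.color_eq (h.mem_edgeColors hL hl hw (by simpa using he))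
    refine ⟨s(a, b), by simpa using hab, ?_, hc⟩
    rw [Sym2.mem_iff, not_or]
    exact ⟨fun h => hw (h ▸ ha), fun h => hw (h ▸ hb)⟩
  · exact ⟨e, he, hwe, rfl⟩

/-- An alternating path starting in the canonical edge `i` and ending in the canonical edge `j`
allows to move the color of the latter to an edge leaving the matching. -/
lemma exists_matching_of_alternating (h : IsForestFree c t) (hE : IsNewEdgeSet c E) {u : ρ}
    {i j : ι} {a : Bool} (hj : j ≠ i)
    (hcol : c s(Sum.inr u, Sum.inl (i, a)) = pairColor c j)
    (halt : (∃ d, s(Sum.inl (i, !a), Sum.inl (j, d)) ∈ E) ∨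
      ∃ k b d, k ≠ i ∧ k ≠ j ∧ s(Sum.inl (i, !a), Sum.inl (k, b)) ∈ E ∧
        s(Sum.inl (k, !b), Sum.inl (j, d)) ∈ E) :
    ∃ L d, IsRainbowMatching c ((Sum.inr u, Sum.inl (i, a)) :: L) ∧ L.length = t ∧
      Sum.inl (j, d) ∉ edgeVerts L ∧ ∀ r, Sum.inr r ∉ edgeVerts L := by
  have ht := h.card_eq
  have ht2 := h.two_le
  rcases halt with ⟨d, hd⟩ | ⟨k, b, d, hki, hkj, hb, hd⟩
  · refine ⟨_, !d, hE.cons_append_restEdges h.injective {i, j} (Sum.inr u, Sum.inl (i, a))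
      [(Sum.inl (i, !a), Sum.inl (j, d))] (by simp) hcol (by simpa using hd)
      (by simp [Ne.symm hj]) ?_, ?_, ?_, ?_⟩
    · intro k b
      simp
      grind
    · simp [Ne.symm hj, ht]
      omega
    · simp [hj]
    · simp
  · have hcard : ({i, j, k} : Finset ι).card = 3 :=
      Finset.card_eq_three.2 ⟨i, j, k, Ne.symm hj, Ne.symm hki, Ne.symm hkj, rfl⟩
    refine ⟨_, !d, hE.cons_append_restEdges h.injective {i, j, k} (Sum.inr u, Sum.inl (i, a))
      [(Sum.inl (i, !a), Sum.inl (k, b)), (Sum.inl (k, !b), Sum.inl (j, d))] (by simp) hcol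
      (by simp [hb, hd]) (by simp [Ne.symm hj, Ne.symm hki, hkj]) ?_,
      ?_, ?_, ?_⟩
    · intro k b
      simp
      grind
    · simp [ht, hcard]
      omega
    · simp [hj, Ne.symm hkj]
    · simp

lemma eq_of_color (h : IsForestFree c t) (hE : IsNewEdgeSet c E) {u : ρ} {i k : ι} {a d : Bool}
    (hcol : c s(Sum.inr u, Sum.inl (i, a)) = pairColor c i) :
    s(Sum.inl (i, !a), Sum.inl (k, d)) ∉ E := by
  intro he
  have hki : k ≠ i := by
    rintro rfl
    have := pairDegree_self hE k
    rw [pairDegree_eq_sideDegree E k k (!a)] at this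
    have h1 : sideDegree E (Sum.inl (k, !a)) k = 0 := by omega
    simp only [sideDegree, Finset.sum_eq_zero_iff, Finset.mem_univ, true_imp_iff] at h1
    simpa [he] using h1 d
  have hm : IsRainbowMatching c ([(Sum.inl (k, d), Sum.inl (k, !d)),
      (Sum.inr u, Sum.inl (i, a))] ++ restEdges ρ {i, k}) := by
    refine IsRainbowMatching.append_restEdges h.injective ⟨by simp [hki], ?_⟩ ?_ ?_
    · simpa [color_pair, hcol] using h.injective.ne hki
    · intro k b
      simp
      grind
    · intro l hl
      simp only [Finset.mem_insert, Finset.mem_singleton, not_or] at hl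
      simp [color_pair, hcol, h.injective.eq_iff, hl]
  refine h.not_hasRainbowForest ((HasRainbowForest.of_matching_path (c := c) hm
    (x := Sum.inl (i, !a)) (by simp [Ne.symm hki]) (by simp [Ne.symm hki])
    (by simp) ?_ ?_).mono ?_)
  · rw [color_pair c k d]
    exact hE.notMem _ he k
  · have := hE.notMem _ he
    simp [hcol, this, Ne.symm (this _)]
  · have := h.card_eq
    have := h.two_le
    simp [Ne.symm hki]
    omega

lemma mem_edgeVerts_of_length_eq (h : IsForestFree c t) (u : ρ) (i : ι) (a : Bool)
    {L : List ((ι × Bool ⊕ ρ) × (ι × Bool ⊕ ρ))} (hL : IsRainbowMatching c L)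
    (hl : L.length = t + 1) : Sum.inl (i, a) ∈ edgeVerts L := by
  by_contra hy
  obtain ⟨E, hE, hav, hcard, hcov⟩ := h.exists_avoiding hL hl hy
  have hav' : ∀ k, sideDegree E (Sum.inl (i, a)) k = 0 := fun k =>
    sideDegree_eq_zero fun b he => hav _ he (by simp)
  obtain ⟨j, hcol⟩ := h.exists_pairColor u (v := Sum.inl (i, a)) (by simp)
  by_cases hj : j = i
  · subst hj
    have h0 : ∀ k, pairDegree E k j = 0 := fun k => by
      rw [pairDegree_comm, pairDegree_eq_sideDegree E j k a, hav',
        sideDegree_eq_zero fun d => h.eq_of_color hE hcol]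
    exact h.false_of_sum_le hE hcard (J := {j}) (m := 0) (by simp) (by simp [h0])
      fun k _ => by simp [h0]
  by_cases halt : (∃ d, s(Sum.inl (i, !a), Sum.inl (j, d)) ∈ E) ∨
      ∃ k b d, k ≠ i ∧ k ≠ j ∧ s(Sum.inl (i, !a), Sum.inl (k, b)) ∈ E ∧
        s(Sum.inl (k, !b), Sum.inl (j, d)) ∈ E
  · obtain ⟨L', d, h1, h2, h3, h4⟩ := h.exists_matching_of_alternating hE hj hcol halt
    have hL'y : Sum.inl (i, a) ∉ edgeVerts L' := by
      have := h1.1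
      simp only [edgeVerts_cons, List.nodup_cons] at this
      exact this.2.1
    have hL' : IsRainbowMatching c L' := h1.sublist (List.sublist_cons_self _ _)
    have hyw : (Sum.inl (j, d) : ι × Bool ⊕ ρ) ≠ Sum.inl (i, a) := by simp [hj]
    let Q : Finset (ι × Bool ⊕ ρ) :=
      Finset.univ.image Sum.inl \ {Sum.inl (i, a), Sum.inl (j, d)}
    have hQmem : ∀ v, v ∈ Q ↔ (∀ r, v ≠ Sum.inr r) ∧ v ≠ Sum.inl (i, a) ∧ v ≠ Sum.inl (j, d) := by
      intro v
      rcases v with v | r <;> simp [Q]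
    have hQ : Q.card = 2 * t := by
      rw [Finset.card_sdiff_of_subset (by simp [Finset.insert_subset_iff]),
        Finset.card_image_of_injective _ Sum.inl_injective, Finset.card_pair hyw.symm]
      simp [h.card_eq]
      omega
    have hmemQ : ∀ v ∈ edgeVerts L', v ∈ Q := fun v hv => (hQmem v).2
      ⟨fun r hr => h4 r (hr ▸ hv), fun hr => hL'y (hr ▸ hv), fun hr => h3 (hr ▸ hv)⟩
    have hcov' : ∀ k ∈ usedColors c, k ≠ pairColor c i → k ≠ pairColor c j →
        ∃ a ∈ Q, ∃ b ∈ Q, a ≠ b ∧ c s(a, b) = k := by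
      intro k hk hki hkj
      by_cases hkp : ∃ l, k = pairColor c l
      · obtain ⟨l, rfl⟩ := hkp
        have hli : l ≠ i := fun hh => hki (by rw [hh])
        have hlj : l ≠ j := fun hh => hkj (by rw [hh])
        exact ⟨Sum.inl (l, false), (hQmem _).2 (by simp [hli, hlj]), Sum.inl (l, true),
          (hQmem _).2 (by simp [hli, hlj]), by simp, rfl⟩
      · push Not at hkp
        obtain ⟨e, he, rfl⟩ := hcov k hk hkp
        by_cases hw : Sum.inl (j, d) ∈ e
        · obtain ⟨w', rfl⟩ := Sym2.mem_iff_exists.1 hw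
          have := h.mem_edgeColors h1 (by simp [h2]) (w := Sum.inl (j, d)) (by simp [h3, hj])
            (by simpa using hE.not_isDiag _ he)
          rw [edgeColors_cons, List.mem_cons] at this
          obtain ⟨p, hp, q, hq, hpq, hc⟩ :=
            hL'.color_eq (this.resolve_left (by rw [hcol]; exact hkj))
          exact ⟨p, hmemQ p hp, q, hmemQ q hq, hpq, hc⟩
        · have hyE := hav e he
          induction e with | _ p q =>
          simp only [Sym2.mem_iff, not_or] at hw hyE
          refine ⟨p, (hQmem p).2 ⟨?_, Ne.symm hyE.1, Ne.symm hw.1⟩, q,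
            (hQmem q).2 ⟨?_, Ne.symm hyE.2, Ne.symm hw.2⟩,
            by simpa using hE.not_isDiag _ he, rfl⟩
          · rintro r rfl
            exact h.inr_notMem hE r q he
          · rintro r rfl
            exact h.inr_notMem hE r p (Sym2.eq_swap ▸ he)
    obtain ⟨hR, hR'⟩ := isRainbowOn_of_card hQ h.le_card hcov'
    have hpc : c s(Sum.inl (i, !a), Sum.inl (i, a)) = pairColor c i := by
      rw [Sym2.eq_swap, color_pair c i a]
    refine h.not_hasRainbowForest (HasRainbowForest.of_isRainbowOn h.two_le hR hQ
      (u := Sum.inr u) (w := Sum.inl (j, d)) (x := Sum.inl (i, !a)) (y := Sum.inl (i, a))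
      (by simp [hQmem]) (by simp [hQmem]) (by simp [hQmem])
      ((hQmem _).2 (by simp [Ne.symm hj])) (by simp) (by simp) hyw ?_ ?_)
    · rw [hpc, hcol]
      exact h.injective.ne (Ne.symm hj)
    · rwa [hpc, hcol]
  · push Not at halt
    have h0 : pairDegree E i j = 0 := by
      rw [pairDegree_eq_sideDegree E i j a, hav', sideDegree_eq_zero halt.1]
    refine h.false_of_sum_le hE hcard (J := {i, j}) (m := 1) (by simp [Ne.symm hj]) ?_ ?_
    · simp [Finset.sum_pair (Ne.symm hj), h0, pairDegree_comm E j i, pairDegree_self hE]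
    · intro k hk
      simp only [Finset.mem_insert, Finset.mem_singleton, not_or] at hk
      have h1 := two_mul_sideDegree_add_le (E := E) (x := Sum.inl (i, !a)) (i := k) (j := j)
        fun b d hb => halt.2 k b d hk.1 hk.2 hb
      rw [Finset.sum_pair (Ne.symm hj), pairDegree_comm E k i, pairDegree_eq_sideDegree E i k a,
        hav']
      omega

protected theorem false (h : IsForestFree c t) (u : ρ) : False := by
  obtain ⟨i⟩ : Nonempty ι := Fintype.card_pos_iff.1 (by rw [h.card_eq]; omega)
  obtain ⟨E, hE, -, hcard, -⟩ := exists_isNewEdgeSet c h.injective (fun _ => True)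
    fun e he _ => ⟨e, he, trivial, rfl⟩
  choose j hcol using fun a => h.exists_pairColor u (v := Sum.inl (i, a)) (by simp)
  have hj : ∀ a, j a ≠ i := by
    intro a hja
    have := h.mem_edgeVerts_of_length_eq u i (!a)
      (hE.cons_append_restEdges h.injective {i} (Sum.inr u, Sum.inl (i, a)) [] (by simp)
        (hja ▸ hcol a) (by simp) (by simp) (by simp)) (by simp [h.card_eq])
    simp at this
  have halt : ∀ a, ¬ ((∃ d, s(Sum.inl (i, !a), Sum.inl (j a, d)) ∈ E) ∨
      ∃ k b d, k ≠ i ∧ k ≠ j a ∧ s(Sum.inl (i, !a), Sum.inl (k, b)) ∈ E ∧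
        s(Sum.inl (k, !b), Sum.inl (j a, d)) ∈ E) := by
    intro a halt
    obtain ⟨L, d, h1, h2, h3, h4⟩ := h.exists_matching_of_alternating hE (hj a) (hcol a) halt
    have := h.mem_edgeVerts_of_length_eq u (j a) d h1 (by simp [h2])
    simp [h3, hj a] at this
  push Not at halt
  have h0 : ∀ a, sideDegree E (Sum.inl (i, !a)) (j a) = 0 := fun a =>
    sideDegree_eq_zero (halt a).1
  have h2 : ∀ a k, k ≠ i → k ≠ j a →
      2 * sideDegree E (Sum.inl (i, !a)) k + pairDegree E k (j a) ≤ 4 := fun a k hki hkj =>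
    two_mul_sideDegree_add_le fun b d hb => (halt a).2 k b d hki hkj hb
  have hD := fun k => pairDegree_eq_sideDegree E i k false
  have h0f := h0 false
  have h0t := h0 true
  have h2f := h2 false
  have h2t := h2 true
  simp only [Bool.not_false, Bool.not_true] at h0f h0t h2f h2t hD
  by_cases hjj : j false = j true
  · rw [← hjj] at h0t h2t
    refine h.false_of_sum_le hE hcard (J := {i, j false}) (m := 1)
      (by simp [Ne.symm (hj false)]) ?_ ?_
    · simp [Finset.sum_pair (Ne.symm (hj false)), pairDegree_comm E (j false) i,
        pairDegree_self hE, hD, h0f, h0t]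
    · intro k hk
      simp only [Finset.mem_insert, Finset.mem_singleton, not_or] at hk
      have h3 := h2f k hk.1 hk.2
      have h4 := h2t k hk.1 hk.2
      rw [Finset.sum_pair (Ne.symm (hj false)), pairDegree_comm E k i, hD]
      omega
  · have hs : ∀ f : ι → ℕ, ∑ k ∈ {i, j false, j true}, f k = f i + (f (j false) + f (j true)) := by
      intro f
      rw [Finset.sum_insert (by simp [Ne.symm (hj _)]), Finset.sum_pair hjj]
    refine h.false_of_sum_le hE hcard (J := {i, j false, j true}) (m := 2)
      (Finset.card_eq_three.2 ⟨_, _, _, Ne.symm (hj _), Ne.symm (hj _), hjj, rfl⟩) ?_ ?_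
    · have h3 := h2f (j true) (hj _) (Ne.symm hjj)
      have h4 := h2t (j false) (hj _) hjj
      have h5 := pairDegree_self hE i
      rw [pairDegree_comm E (j true)] at h3
      rw [hD] at h5
      simp only [hs, pairDegree_self hE, pairDegree_comm E _ i, pairDegree_comm E (j true), hD]
      omega
    · intro k hk
      simp only [Finset.mem_insert, Finset.mem_singleton, not_or] at hk
      have h3 := h2f k hk.1 hk.2.1
      have h4 := h2t k hk.1 hk.2.2
      rw [hs, pairDegree_comm E k i, hD]
      omega

end IsForestFree

end forestFree

theorem hasRainbowForest_of_card {V : Type*} [Fintype V] [DecidableEq V] {c : Sym2 V → ℕ} {u : ℕ}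
    (hu : 1 ≤ u) (hn : 2 * (u + 1) + 3 ≤ Fintype.card V)
    (hA : (u + 1) * (2 * u + 1) + 2 ≤ (usedColors c).card)
    (hB : u * (2 * Fintype.card V) + 4 ≤ 2 * (usedColors c).card + u * (u + 1)) :
    HasRainbowForest c (u + 1) := by
  obtain ⟨s, e, h1, h2⟩ := (hasRainbowMatching_of_card hn hA hB).exists_equiv
  by_contra hF
  obtain ⟨x, hx⟩ : s.Nonempty := by
    rw [← Finset.card_pos]
    omega
  refine IsForestFree.false (t := u + 1) ⟨h1, fun h => hF (h.of_comp e.injective), by simp,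
    by omega, ?_⟩ ⟨x, hx⟩
  rw [usedColors_comp]
  linarith

section translation

lemma colorCount_eq_card_usedColors {n : ℕ} (c : Sym2 (Fin n) → ℕ) :
    colorCount n c = (usedColors c).card := by
  rw [colorCount, ← Set.ncard_coe_finset]
  congr 1
  ext k
  rw [Finset.mem_coe, mem_usedColors]
  constructor
  · rintro ⟨e, he, rfl⟩
    induction e with | _ a b =>
    exact ⟨a, b, by simpa using he, rfl⟩
  · rintro ⟨a, b, hab, rfl⟩
    exact ⟨s(a, b), by simpa using hab, rfl⟩

lemma linearForest_adj_inl {k t : ℕ} {i j : Fin k} {a b : Fin 3} :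
    (linearForest k t).Adj (Sum.inl (i, a)) (Sum.inl (j, b)) ↔
      i = j ∧ ((a : ℕ) + 1 = b ∨ (b : ℕ) + 1 = a) := by
  simp only [linearForest, fromRel_adj]
  constructor
  · rintro ⟨-, h⟩
    simp at h
    grind
  · rintro ⟨rfl, h⟩
    refine ⟨?_, ?_⟩
    · rintro ⟨⟩
      omega
    · simpa using h

lemma linearForest_adj_inr {k t : ℕ} {i j : Fin t} {a b : Fin 2} :
    (linearForest k t).Adj (Sum.inr (i, a)) (Sum.inr (j, b)) ↔ i = j ∧ a ≠ b := by
  simp only [linearForest, fromRel_adj]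
  constructor
  · rintro ⟨-, h⟩
    simp at h
    grind
  · rintro ⟨rfl, h⟩
    refine ⟨by simpa using h, ?_⟩
    simp
    omega

lemma linearForest_not_adj_inl_inr {k t : ℕ} {x : Fin k × Fin 3} {y : Fin t × Fin 2} :
    ¬ (linearForest k t).Adj (Sum.inl x) (Sum.inr y) := by
  simp [linearForest, fromRel_adj]

lemma mem_edgeSet_linearForest {t : ℕ} {e : Sym2 (Fin 1 × Fin 3 ⊕ Fin t × Fin 2)}
    (he : e ∈ (linearForest 1 t).edgeSet) :
    e = s(Sum.inl (0, 0), Sum.inl (0, 1)) ∨ e = s(Sum.inl (0, 1), Sum.inl (0, 2)) ∨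
      ∃ j, e = s(Sum.inr (j, 0), Sum.inr (j, 1)) := by
  induction e with | _ u v =>
  rw [mem_edgeSet] at he
  rcases u with ⟨i, a⟩ | ⟨i, a⟩ <;> rcases v with ⟨j, b⟩ | ⟨j, b⟩
  · rw [linearForest_adj_inl] at he
    obtain rfl := Subsingleton.elim i 0
    obtain rfl := Subsingleton.elim j 0
    fin_cases a <;> fin_cases b <;> simp_all
  · exact absurd he linearForest_not_adj_inl_inr
  · exact absurd he.symm linearForest_not_adj_inl_inr
  · rw [linearForest_adj_inr] at he
    obtain ⟨rfl, he⟩ := he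
    refine Or.inr (Or.inr ⟨i, ?_⟩)
    fin_cases a <;> fin_cases b <;> simp_all

lemma HasRainbowForest.hasRainbowCopy {n t : ℕ} {c : Sym2 (Fin n) → ℕ}
    (h : HasRainbowForest c t) :
    HasRainbowCopy (linearForest 1 t) (⊤ : SimpleGraph (Fin n)) c := by
  obtain ⟨x, y, z, L, hv, hc, rfl⟩ := h
  simp only [List.nodup_cons, List.mem_cons, not_or] at hv hc
  let f : Fin 1 × Fin 3 ⊕ Fin L.length × Fin 2 → Fin n :=
    Sum.elim (fun p => ![x, y, z] p.2) fun p => ![L[p.1].1, L[p.1].2] p.2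
  have hmem : ∀ p : Fin L.length × Fin 2, f (Sum.inr p) ∈ edgeVerts L := by
    rintro ⟨i, a⟩
    refine mem_edgeVerts.2 ⟨L[i], List.getElem_mem _, ?_⟩
    fin_cases a <;> simp [f]
  have hf : Function.Injective f := by
    rintro (⟨i, a⟩ | ⟨i, a⟩) (⟨j, b⟩ | ⟨j, b⟩) hij
    · obtain rfl := Subsingleton.elim i j
      simp only [f, Sum.elim_inl] at hij
      fin_cases a <;> fin_cases b <;> simp_all
    · have := hmem (j, b)
      rw [← hij] at this
      simp only [f, Sum.elim_inl] at this
      fin_cases a <;> simp_all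
    · have := hmem (i, a)
      rw [hij] at this
      simp only [f, Sum.elim_inl] at this
      fin_cases b <;> simp_all
    · have hij' : i = j := by
        apply Fin.ext
        refine edgeVerts_getElem_eq hv.2.2.2 i.2 j.2 (v := f (Sum.inr (i, a))) ?_ ?_
        · fin_cases a <;> simp [f]
        · rw [hij]
          fin_cases b <;> simp [f]
      subst hij'
      have hne : L[i].1 ≠ L[i].2 :=
        IsRainbowMatching.fst_ne_snd ⟨hv.2.2.2, hc.2.2⟩ (List.getElem_mem i.2)
      fin_cases a <;> fin_cases b <;> simp_all [f]
  refine ⟨⟨f, fun hab => by simpa using hf.ne hab.ne⟩, hf, ?_⟩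
  have hcol : ∀ j : Fin L.length, c s(L[j].1, L[j].2) ∈ edgeColors c L := fun j =>
    mem_edgeColors.2 ⟨L[j], List.getElem_mem _, rfl⟩
  have hinj : ∀ i j : Fin L.length, c s(L[i].1, L[i].2) = c s(L[j].1, L[j].2) → i = j := by
    intro i j hij
    have h2 := hc.2.2
    unfold edgeColors at h2
    have := (List.nodup_iff_injective_get.1 h2) (a₁ := i.cast (by simp)) (a₂ := j.cast (by simp))
      (by simpa using hij)
    simpa [Fin.ext_iff] using this
  intro e he e' he' hee
  rcases mem_edgeSet_linearForest he with rfl | rfl | ⟨i, rfl⟩ <;>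
    rcases mem_edgeSet_linearForest he' with rfl | rfl | ⟨j, rfl⟩ <;>
    simp only [RelHom.coeFn_mk, Sym2.map_mk, f, Sum.elim_inl, Sum.elim_inr] at hee ⊢ <;>
    simp at hee
  · exact absurd hee hc.1.1
  · exact absurd (hee ▸ hcol j) hc.1.2
  · exact absurd hee.symm hc.1.1
  · exact absurd (hee ▸ hcol j) hc.2.1
  · exact absurd (hee ▸ hcol i) hc.1.2
  · exact absurd (hee ▸ hcol i) hc.2.1
  · rw [hinj i j (by simpa using hee)]

end translation

section constructions

variable {V : Type*} [DecidableEq V]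

/-- The edges of the complete graph on `S`. -/
def cliqueEdges (S : Finset V) : Finset (Sym2 V) := S.offDiag.image Sym2.mk.uncurry

@[simp] lemma mk_mem_cliqueEdges {S : Finset V} {a b : V} :
    s(a, b) ∈ cliqueEdges S ↔ a ∈ S ∧ b ∈ S ∧ a ≠ b := by
  simp only [cliqueEdges, Finset.mem_image, Finset.mem_offDiag, Prod.exists,
    Function.uncurry_apply_pair, Sym2.eq_iff]
  grind

lemma card_cliqueEdges (S : Finset V) : (cliqueEdges S).card = S.card.choose 2 :=
  Sym2.card_image_offDiag S

variable [Fintype V]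

/-- The coloring giving pairwise distinct nonzero colors to the edges of `E` and the color `0` to
all other edges. -/
noncomputable def patternColoring (E : Finset (Sym2 V)) (e : Sym2 V) : ℕ :=
  if e ∈ E then (Fintype.equivFin (Sym2 V) e : ℕ) + 1 else 0

lemma patternColoring_of_notMem {E : Finset (Sym2 V)} {e : Sym2 V} (he : e ∉ E) :
    patternColoring E e = 0 := if_neg he

lemma card_usedColors_patternColoring {E : Finset (Sym2 V)} (hE : ∀ e ∈ E, ¬ e.IsDiag)
    {e : Sym2 V} (he : e ∉ E) (he' : ¬ e.IsDiag) :
    (usedColors (patternColoring E)).card = E.card + 1 := by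
  have hval : ∀ e ∈ E, patternColoring E e = (Fintype.equivFin (Sym2 V) e : ℕ) + 1 :=
    fun e he => if_pos he
  have hU : usedColors (patternColoring E) = insert 0 (E.image (patternColoring E)) := by
    ext k
    rw [Finset.mem_insert, Finset.mem_image, mem_usedColors]
    constructor
    · rintro ⟨a, b, -, rfl⟩
      by_cases h : s(a, b) ∈ E
      · exact Or.inr ⟨_, h, rfl⟩
      · exact Or.inl (patternColoring_of_notMem h)
    · rintro (rfl | ⟨e, he, rfl⟩)
      · induction e with | _ a b =>
        exact ⟨a, b, by simpa using he', patternColoring_of_notMem he⟩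
      · induction e with | _ a b =>
        exact ⟨a, b, by simpa using hE _ he, rfl⟩
  rw [hU, Finset.card_insert_of_notMem, Finset.card_image_of_injOn]
  · intro e he e' he' hee
    rw [hval e he, hval e' he'] at hee
    exact (Fintype.equivFin (Sym2 V)).injective (Fin.ext (by omega))
  · rw [Finset.mem_image]
    rintro ⟨e, he, h⟩
    rw [hval e he] at h
    omega

end constructions

section lowerBounds

variable {n t : ℕ}

lemma exists_linearForest_adj (v : Fin 1 × Fin 3 ⊕ Fin t × Fin 2) :
    ∃ w, (linearForest 1 t).Adj v w := by
  rcases v with ⟨i, a⟩ | ⟨j, b⟩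
  · by_cases ha : a = 1
    · exact ⟨Sum.inl (i, 0), linearForest_adj_inl.2 ⟨rfl, by simp [ha]⟩⟩
    · exact ⟨Sum.inl (i, 1), linearForest_adj_inl.2 ⟨rfl, by fin_cases a <;> simp_all⟩⟩
  · exact ⟨Sum.inr (j, 1 - b), linearForest_adj_inr.2 ⟨rfl, by fin_cases b <;> simp⟩⟩

lemma not_hasRainbowCopy_cliqueEdges {S : Finset (Fin n)} (hS : S.card ≤ 2 * t) :
    ¬ HasRainbowCopy (linearForest 1 t) (⊤ : SimpleGraph (Fin n))
      (patternColoring (cliqueEdges S)) := by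
  rintro ⟨f, hf, hr⟩
  have hzero : ∀ v w, f v ∉ S → patternColoring (cliqueEdges S) (Sym2.map f s(v, w)) = 0 := by
    intro v w hv
    refine patternColoring_of_notMem ?_
    simp [hv]
  let T : Finset (Fin 1 × Fin 3 ⊕ Fin t × Fin 2) := Finset.univ.filter fun v => f v ∉ S
  have hT : 3 ≤ T.card := by
    have h1 := Finset.card_filter_add_card_filter_not (s := Finset.univ) fun v => f v ∈ S
    have h2 : (Finset.univ.filter fun v => f v ∈ S).card ≤ S.card :=
      Finset.card_le_card_of_injOn f (by intro v; simp) hf.injOn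
    simp only [Finset.card_univ, Fintype.card_sum, Fintype.card_prod, Fintype.card_fin] at h1
    lia
  obtain ⟨v, hv⟩ : T.Nonempty := Finset.card_pos.1 (by omega)
  obtain ⟨w, hvw⟩ := exists_linearForest_adj v
  have hsub : T ⊆ {v, w} := by
    intro v' hv'
    obtain ⟨w', hvw'⟩ := exists_linearForest_adj v'
    have := hr ((mem_edgeSet _).2 hvw') ((mem_edgeSet _).2 hvw) (by
      simp only [hzero v' w' (Finset.mem_filter.1 hv').2, hzero v w (Finset.mem_filter.1 hv).2])
    have hmem : v' ∈ s(v, w) := by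
      rw [← this]
      simp
    simpa using hmem
  have := (Finset.card_le_card hsub).trans Finset.card_le_two
  omega

lemma not_hasRainbowCopy_sdiff_cliqueEdges {S : Finset (Fin n)} (hS : S.card + 1 ≤ t) :
    ¬ HasRainbowCopy (linearForest 1 t) (⊤ : SimpleGraph (Fin n))
      (patternColoring (cliqueEdges Finset.univ \ cliqueEdges Sᶜ)) := by
  rintro ⟨f, hf, hr⟩
  have hzero : ∀ v w, v ≠ w → f v ∉ S → f w ∉ S →
      patternColoring (cliqueEdges Finset.univ \ cliqueEdges Sᶜ) (Sym2.map f s(v, w)) = 0 := by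
    intro v w hvw hv hw
    refine patternColoring_of_notMem ?_
    simp [hv, hw, hf.ne hvw]
  let φ : Fin 1 × Fin 3 ⊕ Fin t × Fin 2 → Option (Fin t) :=
    Sum.elim (fun _ => none) fun p => some p.1
  let A : Finset (Option (Fin t)) := (Finset.univ.filter fun v => f v ∈ S).image φ
  have hA : A.card ≤ S.card := Finset.card_image_le.trans
    (Finset.card_le_card_of_injOn f (by intro v; simp) hf.injOn)
  have hA' : 1 < Aᶜ.card := by
    rw [Finset.card_compl]
    simp
    omega
  have hout : ∀ i ∉ A, ∀ v, φ v = i → f v ∉ S := fun i hi v hv hfv =>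
    hi (Finset.mem_image.2 ⟨v, by simpa using hfv, hv⟩)
  have hedge : ∀ i ∉ A, ∃ e ∈ (linearForest 1 t).edgeSet,
      patternColoring (cliqueEdges Finset.univ \ cliqueEdges Sᶜ) (Sym2.map f e) = 0 ∧
        ∃ v ∈ e, ∀ w ∈ e, φ w = i := by
    rintro (_ | j) hi
    · exact ⟨s(Sum.inl (0, 0), Sum.inl (0, 1)), linearForest_adj_inl.2 (by simp),
        hzero _ _ (by simp) (hout _ hi _ rfl) (hout _ hi _ rfl), Sum.inl (0, 0), by simp,
        by simp [φ]⟩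
    · exact ⟨s(Sum.inr (j, 0), Sum.inr (j, 1)), linearForest_adj_inr.2 (by simp),
        hzero _ _ (by simp) (hout _ hi _ rfl) (hout _ hi _ rfl), Sum.inr (j, 0), by simp,
        by simp [φ]⟩
  obtain ⟨i, hi, j, hj, hij⟩ := Finset.one_lt_card.1 hA'
  obtain ⟨e, he, he0, v, hv, hev⟩ := hedge i (Finset.mem_compl.1 hi)
  obtain ⟨e', he', he0', v', hv', hev'⟩ := hedge j (Finset.mem_compl.1 hj)
  obtain rfl := hr he he' (he0.trans he0'.symm)
  exact hij ((hev v hv).symm.trans (hev' v hv))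

lemma antiRamsey_eq {m : ℕ} {W : Type} {F : SimpleGraph W} {c : Sym2 (Fin n) → ℕ}
    (hc : ¬ HasRainbowCopy F (⊤ : SimpleGraph (Fin n)) c) (hm : (usedColors c).card = m)
    (h : ∀ c' : Sym2 (Fin n) → ℕ, m + 1 ≤ (usedColors c').card →
      HasRainbowCopy F (⊤ : SimpleGraph (Fin n)) c') : antiRamsey n F = m := by
  refine IsGreatest.csSup_eq ⟨⟨c, (colorCount_eq_card_usedColors c).trans hm, hc⟩, ?_⟩
  rintro k ⟨c', rfl, hc'⟩
  rw [colorCount_eq_card_usedColors]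
  by_contra! hlt
  exact hc' (h c' hlt)

end lowerBounds

lemma two_mul_choose_two (k : ℕ) : 2 * k.choose 2 = k * (k - 1) := by
  rw [Nat.choose_two_right, Nat.mul_div_cancel' (Nat.even_mul_pred_self k).two_dvd]

lemma antiRamsey_eq_of_le {u n : ℕ} (hu : 1 ≤ u) (hn : 2 * (u + 1) + 3 ≤ n)
    (h : 2 * n * u ≤ 5 * u * u + 7 * u + 2) :
    antiRamsey n (linearForest 1 (u + 1)) = (u + 1) * (2 * u + 1) + 1 := by
  obtain ⟨S, -, hS⟩ := Finset.exists_subset_card_eq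
    (s := (Finset.univ : Finset (Fin n))) (n := 2 * (u + 1)) (by simp; omega)
  obtain ⟨a, b, ha, hab⟩ : ∃ a b, a ∉ S ∧ a ≠ b := by
    obtain ⟨a, ha, b, -, hab⟩ := Finset.one_lt_card.1
      (show 1 < Sᶜ.card by rw [Finset.card_compl, Fintype.card_fin]; omega)
    exact ⟨a, b, Finset.mem_compl.1 ha, hab⟩
  refine antiRamsey_eq (not_hasRainbowCopy_cliqueEdges hS.le) ?_ fun c hc =>
    (hasRainbowForest_of_card hu (by simpa using hn) hc ?_).hasRainbowCopy
  · rw [card_usedColors_patternColoring (e := s(a, b)) ?_ (by simp [ha]) (by simpa using hab),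
      card_cliqueEdges, hS]
    · have := two_mul_choose_two (2 * (u + 1))
      rw [show 2 * (u + 1) - 1 = 2 * u + 1 by omega] at this
      linarith
    · intro e he
      induction e with | _ p q =>
      simpa using (mk_mem_cliqueEdges.1 he).2.2
  · rw [Fintype.card_fin]
    linarith

lemma antiRamsey_eq_of_ge {u n : ℕ} (hu : 1 ≤ u) (hn : 2 * (u + 1) + 3 ≤ n)
    (h : 5 * u * u + 7 * u + 2 ≤ 2 * n * u) :
    antiRamsey n (linearForest 1 (u + 1)) = u * (2 * n - (u + 1)) / 2 + 1 := by
  obtain ⟨S, -, hS⟩ := Finset.exists_subset_card_eq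
    (s := (Finset.univ : Finset (Fin n))) (n := u) (by simp; omega)
  have hS' : Sᶜ.card = n - u := by rw [Finset.card_compl, Fintype.card_fin, hS]
  obtain ⟨a, ha, b, hb, hab⟩ := Finset.one_lt_card.1 (show 1 < Sᶜ.card by omega)
  obtain ⟨m, rfl⟩ := Nat.exists_eq_add_of_le hn
  have hchoose : ((2 * (u + 1) + 3 + m).choose 2 - (2 * (u + 1) + 3 + m - u).choose 2) =
      u * (2 * (2 * (u + 1) + 3 + m) - (u + 1)) / 2 := by
    have h1 := two_mul_choose_two (2 * (u + 1) + 3 + m)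
    have h2 := two_mul_choose_two (2 * (u + 1) + 3 + m - u)
    rw [show 2 * (u + 1) + 3 + m - 1 = 2 * u + 4 + m by omega] at h1
    rw [show 2 * (u + 1) + 3 + m - u = u + 5 + m by omega] at h2 ⊢
    rw [show u + 5 + m - 1 = u + 4 + m by omega] at h2
    rw [show 2 * (2 * (u + 1) + 3 + m) - (u + 1) = 3 * u + 9 + 2 * m by omega]
    have h3 : 2 * (2 * (u + 1) + 3 + m).choose 2 =
        u * (3 * u + 9 + 2 * m) + 2 * (u + 5 + m).choose 2 := by
      rw [h1, h2]
      ring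
    omega
  have heven : 2 ∣ u * (2 * (2 * (u + 1) + 3 + m) - (u + 1)) := by
    rw [show 2 * (2 * (u + 1) + 3 + m) - (u + 1) = (u + 1) + 2 * (u + 4 + m) by omega, mul_add]
    exact dvd_add (Nat.even_mul_succ_self u).two_dvd ⟨u * (u + 4 + m), by ring⟩
  refine antiRamsey_eq (not_hasRainbowCopy_sdiff_cliqueEdges (S := S) (by omega)) ?_ fun c hc =>
    (hasRainbowForest_of_card hu (by simp) ?_ ?_).hasRainbowCopy
  · rw [card_usedColors_patternColoring (e := s(a, b)) ?_ (by simp_all) (by simpa using hab),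
      Finset.card_sdiff_of_subset, card_cliqueEdges, card_cliqueEdges, hS', Finset.card_univ,
      Fintype.card_fin, hchoose]
    · intro e he
      induction e with | _ p q =>
      simpa using (mk_mem_cliqueEdges.1 he).2.2
    · intro e he
      induction e with | _ p q =>
      rw [Finset.mem_sdiff, mk_mem_cliqueEdges] at he
      simpa using he.1.2.2
  all_goals
    obtain ⟨w, hw⟩ := heven
    rw [hw, Nat.mul_div_cancel_left _ two_pos] at hc
    rw [show 2 * (2 * (u + 1) + 3 + m) - (u + 1) = 3 * u + 9 + 2 * m by omega] at hw
  · linarith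
  · rw [Fintype.card_fin]
    linarith

/-- He and Jin's theorem: for `t ≥ 2` and `μ = (5t + 2)/2 + 1/(t − 1)`, the anti-Ramsey
number of `P₃ ∪ tP₂` equals `t(2t − 1) + 1` when `2t + 3 ≤ n ≤ ⌊μ⌋`, and equals
`(t − 1)(2n − t)/2 + 1` when `n ≥ ⌈μ⌉`. -/
theorem antiRamsey_P3_union_matching (t : ℕ) (ht : 2 ≤ t) (μ : ℝ)
    (hμ : μ = (5 * t + 2) / 2 + 1 / ((t : ℝ) - 1)) (n : ℕ) :
    (2 * t + 3 ≤ n → n ≤ ⌊μ⌋₊ →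
      antiRamsey n (linearForest 1 t) = t * (2 * t - 1) + 1) ∧
    (⌈μ⌉₊ ≤ n →
      antiRamsey n (linearForest 1 t) = (t - 1) * (2 * n - t) / 2 + 1) := by
  obtain ⟨u, rfl⟩ := Nat.exists_eq_add_of_le' (one_le_two.trans ht)
  have hu : 1 ≤ u := by omega
  have hu' : (0 : ℝ) < u := by exact_mod_cast hu
  have hμu : 2 * μ * u = 5 * u * u + 7 * u + 2 := by
    rw [hμ]
    push_cast
    rw [add_sub_cancel_right]
    field_simp
    ring
  rw [show 2 * (u + 1) - 1 = 2 * u + 1 by omega, Nat.add_sub_cancel]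
  refine ⟨fun hn hle => antiRamsey_eq_of_le hu hn ?_, fun hle => ?_⟩
  · have h1 := (Nat.le_floor_iff' (by omega)).1 hle
    have h2 : 2 * (n : ℝ) * u ≤ 5 * u * u + 7 * u + 2 := by
      rw [← hμu]
      gcongr
    exact_mod_cast h2
  · have h1 := Nat.ceil_le.1 hle
    have h2 : 5 * (u : ℝ) * u + 7 * u + 2 ≤ 2 * n * u := by
      rw [← hμu]
      gcongr
    have h3 : 5 * u * u + 7 * u + 2 ≤ 2 * n * u := by exact_mod_cast h2
    refine antiRamsey_eq_of_ge hu ?_ h3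
    by_contra! hlt
    have h4 : n ≤ 2 * u + 4 := by omega
    nlinarith [Nat.mul_le_mul_right u h4]
end

section
/- For positive integers k, t, and n with k ≥ 1, t ≥ 2, and n = 3k + 2t, there exists an edge-coloring of the complete graph K_n using exactly (3k + 2t − 3)(3k + 2t − 4)/2 + 1 colors such that K_n contains no rainbow subgraph isomorphic to kP₃ ∪ tP₂. Consequently, AR(n, kP₃ ∪ tP₂) ≥ (3k + 2t − 3)(3k + 2t − 4)/2 + 1. (Such a coloring is obtained by rainbow-coloring a complete subgraph on n − 3 vertices and giving all remaining edges one new common color.) -/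
open SimpleGraph

/-- The coloring of `K_n` that is rainbow on the first `m` vertices and gives every other edge
one further common color. -/
noncomputable def cliqueColoring (n m : ℕ) (e : Sym2 (Fin n)) : ℕ :=
  if ∀ v ∈ e, (v : ℕ) < m then (Fintype.equivFin _ e : ℕ) + 1 else 0

theorem cliqueColoring_of_mem {n m : ℕ} {e : Sym2 (Fin n)} {v : Fin n} (hv : v ∈ e)
    (hm : m ≤ v) : cliqueColoring n m e = 0 :=
  if_neg fun h => absurd (h v hv) hm.not_gt

theorem setOf_edge_forall_lt_eq_image {n m : ℕ} (hmn : m ≤ n) :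
    {e ∈ (⊤ : SimpleGraph (Fin n)).edgeSet | ∀ v ∈ e, (v : ℕ) < m} =
      Sym2.map (Fin.castLE hmn) '' (⊤ : SimpleGraph (Fin m)).edgeSet := by
  ext e
  constructor
  · induction e with
    | _ a b =>
      rintro ⟨hab, h⟩
      refine ⟨s(⟨a, h a (by simp)⟩, ⟨b, h b (by simp)⟩), ?_, by simp⟩
      simpa [Fin.ext_iff] using hab
  · rintro ⟨e, he, rfl⟩
    induction e with
    | _ a b => exact ⟨by simpa [Fin.ext_iff] using he, by simp⟩

theorem cliqueColoring_image_edgeSet {n m : ℕ} (hmn : m + 2 ≤ n) :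
    cliqueColoring n m '' (⊤ : SimpleGraph (Fin n)).edgeSet =
      insert 0 ((fun e => (Fintype.equivFin _ e : ℕ) + 1) ''
        {e ∈ (⊤ : SimpleGraph (Fin n)).edgeSet | ∀ v ∈ e, (v : ℕ) < m}) := by
  ext x
  constructor
  · rintro ⟨e, he, rfl⟩
    by_cases h : ∀ v ∈ e, (v : ℕ) < m
    · exact Or.inr ⟨e, ⟨he, h⟩, (if_pos h).symm⟩
    · exact Or.inl (if_neg h)
  · rintro (rfl | ⟨e, ⟨he, h⟩, rfl⟩)
    · exact ⟨s(⟨m, by omega⟩, ⟨m + 1, by omega⟩), by simp,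
        cliqueColoring_of_mem (Sym2.mem_mk_left _ _) le_rfl⟩
    · exact ⟨e, he, if_pos h⟩

theorem colorCount_cliqueColoring {n m : ℕ} (hmn : m + 2 ≤ n) :
    colorCount n (cliqueColoring n m) = m.choose 2 + 1 := by
  have hinj : Function.Injective fun e : Sym2 (Fin n) => (Fintype.equivFin _ e : ℕ) + 1 :=
    (add_left_injective 1).comp (Fin.val_injective.comp (Fintype.equivFin _).injective)
  rw [colorCount, cliqueColoring_image_edgeSet hmn,
    Set.ncard_insert_of_notMem (by simp) (Set.toFinite _),
    Set.ncard_image_of_injective _ hinj, setOf_edge_forall_lt_eq_image (by omega : m ≤ n),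
    Set.ncard_image_of_injective _ (Sym2.map.injective (Fin.castLE_injective _)),
    ← SimpleGraph.coe_edgeFinset, Set.ncard_coe_finset,
    SimpleGraph.card_edgeFinset_top_eq_card_choose_two, Fintype.card_fin]

/-- A graph on `n` vertices without isolated vertices has no rainbow copy in the coloring of
`K_n` whose rainbow clique misses at least three vertices. -/
theorem not_hasRainbowCopy_cliqueColoring {V : Type} [Fintype V] {F : SimpleGraph V} {n m : ℕ}
    (hF : ∀ v, ∃ w, F.Adj v w) (hV : Fintype.card V = n) (hmn : m + 3 ≤ n) :
    ¬ HasRainbowCopy F (⊤ : SimpleGraph (Fin n)) (cliqueColoring n m) := by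
  rintro ⟨f, hf, hc⟩
  have hsurj : Function.Surjective f :=
    ((Fintype.bijective_iff_injective_and_card f).2 ⟨hf, by simpa using hV⟩).2
  have key (i : Fin 3) : ∃ x : V, (f x : ℕ) = m + i := by
    obtain ⟨x, hx⟩ := hsurj ⟨m + i, by omega⟩
    exact ⟨x, by rw [hx]⟩
  choose x hx using key
  choose y hy using fun i => hF (x i)
  have hzero (i : Fin 3) : cliqueColoring n m (Sym2.map f s(x i, y i)) = 0 :=
    cliqueColoring_of_mem (v := f (x i)) (by simp) (by rw [hx]; omega)
  have heq (i j : Fin 3) : s(x i, y i) = s(x j, y j) :=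
    hc (hy i) (hy j) ((hzero i).trans (hzero j).symm)
  have hne (i j : Fin 3) (h : i ≠ j) : x i ≠ x j := fun hij =>
    h (Fin.ext (by have := hx i; have := hx j; rw [hij] at *; omega))
  have h01 := heq 0 1
  have h02 := heq 0 2
  have := hne 0 1 (by decide)
  have := hne 0 2 (by decide)
  have := hne 1 2 (by decide)
  simp only [Sym2.eq_iff] at h01 h02
  grind

theorem linearForest_exists_adj (k t : ℕ) (v : Fin k × Fin 3 ⊕ Fin t × Fin 2) :
    ∃ w, (linearForest k t).Adj v w := by
  rcases v with ⟨i, a⟩ | ⟨j, b⟩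
  · fin_cases a
    · exact ⟨Sum.inl (i, 1), by simp [linearForest]⟩
    · exact ⟨Sum.inl (i, 0), by simp [linearForest]⟩
    · exact ⟨Sum.inl (i, 1), by simp [linearForest]⟩
  · fin_cases b
    · exact ⟨Sum.inr (j, 1), by simp [linearForest]⟩
    · exact ⟨Sum.inr (j, 0), by simp [linearForest]⟩

theorem colorCount_le_antiRamsey {V : Type} {F : SimpleGraph V} {n : ℕ} {c : Sym2 (Fin n) → ℕ}
    (hc : ¬ HasRainbowCopy F (⊤ : SimpleGraph (Fin n)) c) :
    colorCount n c ≤ antiRamsey n F := by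
  refine le_csSup ⟨(⊤ : SimpleGraph (Fin n)).edgeSet.ncard, ?_⟩ ⟨c, rfl, hc⟩
  rintro _ ⟨d, rfl, -⟩
  exact Set.ncard_image_le (Set.toFinite _)

/-- Lower bound: for `k ≥ 1`, `t ≥ 2`, `n = 3k + 2t`, there is an edge-coloring of `K_n`
with exactly `(3k + 2t − 3)(3k + 2t − 4)/2 + 1` colors and no rainbow copy of
`kP₃ ∪ tP₂`; consequently `AR(n, kP₃ ∪ tP₂) ≥ (3k + 2t − 3)(3k + 2t − 4)/2 + 1`. -/
theorem antiRamsey_linearForest_lower (k t n : ℕ) (hk : 1 ≤ k) (ht : 2 ≤ t)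
    (hn : n = 3 * k + 2 * t) :
    (∃ c : Sym2 (Fin n) → ℕ,
      colorCount n c = (3 * k + 2 * t - 3) * (3 * k + 2 * t - 4) / 2 + 1 ∧
      ¬ HasRainbowCopy (linearForest k t) (⊤ : SimpleGraph (Fin n)) c) ∧
    (3 * k + 2 * t - 3) * (3 * k + 2 * t - 4) / 2 + 1 ≤ antiRamsey n (linearForest k t) := by
  have hcount : colorCount n (cliqueColoring n (3 * k + 2 * t - 3)) =
      (3 * k + 2 * t - 3) * (3 * k + 2 * t - 4) / 2 + 1 := by
    rw [colorCount_cliqueColoring (by omega), Nat.choose_two_right, Nat.sub_sub]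
  have hrainbow : ¬ HasRainbowCopy (linearForest k t) (⊤ : SimpleGraph (Fin n))
      (cliqueColoring n (3 * k + 2 * t - 3)) :=
    not_hasRainbowCopy_cliqueColoring (linearForest_exists_adj k t)
      (by simp [hn, mul_comm]) (by omega)
  exact ⟨⟨_, hcount, hrainbow⟩, hcount ▸ colorCount_le_antiRamsey hrainbow⟩
end
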